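/- Let k ≥ 2, let u(x,t) = u_0(x − t) with u_0 : ℝ → ℝ of class C^{k+4}, let u_h be a DG solution on [0,T] (with either the periodic upwind flux, u_0 being 2π-periodic, or the Dirichlet inflow flux), and suppose the initial error satisfies ‖u_h(·,0) − u_I^2(·,0)‖_0 ≤ C₀ h^{k+3} M_{k+4}. Then there is a constant C depending only on k, C₀ and the quasi-uniformity constant c such that for every cell τ_j, every t ∈ [0,T], and every interior right Radau point r of τ_j (i.e. r ∈ (x_{j-1/2}, x_{j+1/2}) with L_{j,k+1}(r) − L_{j,k}(r) = 0), |u(r,t) − u_h(r,t)| ≤ C (1+t) h^{k+2} M_{k+4}. -/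

import Mathlib

open MeasureTheory intervalIntegral

/-- Legendre polynomial of degree `m` via the Rodrigues formula. -/
noncomputable def legendreP (m : ℕ) : ℝ → ℝ :=
  fun s => (1 / ((2:ℝ) ^ m * (Nat.factorial m : ℝ))) *
    iteratedDeriv m (fun t : ℝ => (t ^ 2 - 1) ^ m) s

/-- Legendre polynomial rescaled to the cell `(a, b)`. -/
noncomputable def legendreCell (m : ℕ) (a b : ℝ) : ℝ → ℝ :=
  fun x => legendreP m ((2 * x - (a + b)) / (b - a))

/-- `P` is the Gauss–Radau projection (onto polynomials of degree ≤ k on `(a,b)`) of `u`. -/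
def IsGRProj (k : ℕ) (a b : ℝ) (u : ℝ → ℝ) (P : Polynomial ℝ) : Prop :=
  P.natDegree ≤ k ∧
  (∀ v : Polynomial ℝ, v.natDegree + 1 ≤ k →
    (∫ x in a..b, P.eval x * v.eval x) = ∫ x in a..b, u x * v.eval x) ∧
  P.eval b = u b

/-- The scaled primitive `(D⁻¹ v)(x) = (2/(b-a)) ∫_a^x v`. -/
noncomputable def Dinv (a b : ℝ) (v : ℝ → ℝ) : ℝ → ℝ :=
  fun x => (2 / (b - a)) * ∫ t in a..x, v t

/-- `F` is the sequence of correction polynomials on the cell `(a,b)`: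
`F 1 = P_h^-(D⁻¹ L_k)` and `F i = -P_h^-(D⁻¹ F (i-1))` for `i ≥ 2`. -/
def IsFSeq (k : ℕ) (a b : ℝ) (F : ℕ → Polynomial ℝ) : Prop :=
  IsGRProj k a b (Dinv a b (legendreCell k a b)) (F 1) ∧
  ∀ i, 2 ≤ i → IsGRProj k a b (Dinv a b (fun x => (F (i-1)).eval x)) (-(F i))

/-- The `m`-th Radau coefficient of `w` on the cell `(a,b)`. -/
noncomputable def radauCoeff (a b : ℝ) (w : ℝ → ℝ) (m : ℕ) : ℝ :=
  w b - (1 / (b - a)) *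
    ∫ x in a..b, w x * ∑ l ∈ Finset.range m, (2 * (l:ℝ) + 1) * legendreCell l a b x

/-- `G_i(t) = (d/dt)^i u_{j,k+1}(t)` for `u(x,t) = u0(x - t)` on the cell `(a,b)`. -/
noncomputable def Gfun (k : ℕ) (a b : ℝ) (u0 : ℝ → ℝ) (i : ℕ) (t : ℝ) : ℝ :=
  iteratedDeriv i (fun s => radauCoeff a b (fun y => u0 (y - s)) (k + 1)) t

/-- `w_i(x,t) = (h_j/2)^i G_i(t) F_i(x)` on the cell `(a,b)`. -/
noncomputable def wFun (k : ℕ) (a b : ℝ) (u0 : ℝ → ℝ) (F : ℕ → Polynomial ℝ)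
    (i : ℕ) (y t : ℝ) : ℝ :=
  ((b - a) / 2) ^ i * Gfun k a b u0 i t * (F i).eval y

/-- `w^l = Σ_{i=1}^l w_i` on the cell `(a,b)`. -/
noncomputable def wSum (k : ℕ) (a b : ℝ) (u0 : ℝ → ℝ) (F : ℕ → Polynomial ℝ)
    (l : ℕ) (y t : ℝ) : ℝ :=
  ∑ i ∈ Finset.Icc 1 l, wFun k a b u0 F i y t

/-- The interpolation function `u_I^l = P_h^- u - w^l` on the cell `(a,b)`;
here `P t` is the Gauss–Radau projection of `u(·,t)`. -/
noncomputable def uIl (k : ℕ) (a b : ℝ) (u0 : ℝ → ℝ) (P : ℝ → Polynomial ℝ)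
    (F : ℕ → Polynomial ℝ) (l : ℕ) (y t : ℝ) : ℝ :=
  (P t).eval y - wSum k a b u0 F l y t

/-- `uh` is a DG solution on `[0,T]` on the mesh `x 0 < x 1 < … < x N`
(the piece on the cell `τ_j = (x (j-1), x j)` is the polynomial `uh j t`),
with prescribed inflow value `inflow t` at the left boundary. -/
def IsDGSol (k N : ℕ) (x : ℕ → ℝ) (T : ℝ) (inflow : ℝ → ℝ)
    (uh : ℕ → ℝ → Polynomial ℝ) : Prop :=
  (∀ j ∈ Finset.Icc 1 N, ∀ t : ℝ, (uh j t).natDegree ≤ k) ∧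
  (∀ j ∈ Finset.Icc 1 N, ∀ y : ℝ, ContDiff ℝ 1 (fun t => (uh j t).eval y)) ∧
  (∀ j ∈ Finset.Icc 1 N, ∀ t ∈ Set.Icc (0:ℝ) T, ∀ v : Polynomial ℝ, v.natDegree ≤ k →
    (∫ y in (x (j-1))..(x j), deriv (fun s => (uh j s).eval y) t * v.eval y)
      - (∫ y in (x (j-1))..(x j), (uh j t).eval y * v.derivative.eval y)
      + (uh j t).eval (x j) * v.eval (x j)
      - (if j = 1 then inflow t else (uh (j-1) t).eval (x (j-1))) * v.eval (x (j-1)) = 0)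

/-- The error `u - u_I^l` on the cell `τ_j`, as a function of `(y, s)`. -/
noncomputable def errFun (k l : ℕ) (x : ℕ → ℝ) (u0 : ℝ → ℝ)
    (P : ℕ → ℝ → Polynomial ℝ) (F : ℕ → ℕ → Polynomial ℝ) (j : ℕ) (y s : ℝ) : ℝ :=
  u0 (y - s) - uIl k (x (j-1)) (x j) u0 (P j) (F j) l y s

open Polynomial in
theorem poly_intble (p : ℝ[X]) (a b : ℝ) : IntervalIntegrable (fun x => p.eval x) volume a b :=
  p.continuous.intervalIntegrable a b

open Polynomial in
theorem poly_mul_intble (p q : ℝ[X]) (a b : ℝ) :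
    IntervalIntegrable (fun x => p.eval x * q.eval x) volume a b :=
  (p.continuous.mul q.continuous).intervalIntegrable a b

open Polynomial in
theorem poly_ibp (p q : ℝ[X]) (a b : ℝ) :
    ∫ x in a..b, (derivative p).eval x * q.eval x
      = p.eval b * q.eval b - p.eval a * q.eval a
        - ∫ x in a..b, p.eval x * (derivative q).eval x := by
  have := integral_mul_deriv_eq_deriv_mul (a := a) (b := b)
    (u := fun x => q.eval x) (v := fun x => p.eval x)
    (u' := fun x => (derivative q).eval x) (v' := fun x => (derivative p).eval x)
    (fun x _ => q.hasDerivAt x) (fun x _ => p.hasDerivAt x)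
    (poly_intble _ a b) (poly_intble _ a b)
  simp only [mul_comm (eval _ (derivative p)), this]
  simp only [mul_comm]

/-- Legendre polynomial as a polynomial. -/
noncomputable def legPoly (m : ℕ) : Polynomial ℝ :=
  Polynomial.C (1 / ((2:ℝ) ^ m * (Nat.factorial m : ℝ))) *
    (Polynomial.derivative^[m] ((Polynomial.X ^ 2 - 1) ^ m))

open Polynomial in
theorem iteratedDeriv_poly (p : ℝ[X]) (n : ℕ) :
    iteratedDeriv n (fun x => p.eval x) = fun x => (derivative^[n] p).eval x := by
  induction n with
  | zero => simp
  | succ n ih =>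
    rw [iteratedDeriv_succ, ih]
    funext x
    rw [Polynomial.deriv, Function.iterate_succ_apply']

theorem legendreP_eq (m : ℕ) (s : ℝ) : legendreP m s = (legPoly m).eval s := by
  unfold legendreP legPoly
  have h : (fun t : ℝ => (t ^ 2 - 1) ^ m)
      = fun x => (((Polynomial.X ^ 2 - 1) ^ m : Polynomial ℝ)).eval x := by
    funext x; simp
  rw [h, iteratedDeriv_poly]
  simp

open Polynomial in
theorem leg_bdry (m j : ℕ) (hj : j < m) (s : ℝ) (hs : s ^ 2 = 1) :
    (derivative^[j] ((X ^ 2 - 1 : ℝ[X]) ^ m)).eval s = 0 := by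
  have h := pow_sub_dvd_iterate_derivative_pow (X ^ 2 - 1 : ℝ[X]) m j
  obtain ⟨r, hr⟩ := h
  rw [hr]
  have : m - j ≠ 0 := by omega
  simp [hs, this]

open Polynomial in
theorem leg_orth_aux (m i : ℕ) (hi : i ≤ m) (q : ℝ[X]) (hq : q.natDegree < i) :
    ∫ x in (-1:ℝ)..1, (derivative^[i] ((X ^ 2 - 1 : ℝ[X]) ^ m)).eval x * q.eval x = 0 := by
  induction i generalizing q with
  | zero => omega
  | succ i ih =>
    rw [Function.iterate_succ_apply', poly_ibp, leg_bdry m i (by omega) 1 (by norm_num),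
      leg_bdry m i (by omega) (-1) (by norm_num)]
    by_cases h0 : q.natDegree = 0
    · rw [natDegree_eq_zero] at h0
      obtain ⟨c, rfl⟩ := h0
      simp
    · have := natDegree_derivative_lt h0
      rw [ih (by omega) _ (by omega)]
      simp

open Polynomial in
theorem leg_orth (m : ℕ) (q : ℝ[X]) (hq : q.natDegree < m) :
    ∫ x in (-1:ℝ)..1, (legPoly m).eval x * q.eval x = 0 := by
  have := leg_orth_aux m m le_rfl q hq
  unfold legPoly
  simp only [eval_mul, eval_C, mul_assoc]
  rw [intervalIntegral.integral_const_mul, this, mul_zero]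

open Polynomial in
theorem legPoly_natDegree (m : ℕ) : (legPoly m).natDegree ≤ m := by
  unfold legPoly
  refine natDegree_C_mul_le _ _ |>.trans ?_
  refine (natDegree_iterate_derivative _ _).trans ?_
  have : ((X ^ 2 - 1 : ℝ[X]) ^ m).natDegree ≤ m * 2 := by
    refine natDegree_pow_le_of_le m ?_
    compute_degree
  omega

open Polynomial in
theorem leg_endpt (m : ℕ) (s : ℝ) (hs : s ^ 2 = 1) : (legPoly m).eval s = s ^ m := by
  unfold legPoly
  rw [← factorial_smul_hasseDeriv]
  simp only [eval_mul, eval_C, LinearMap.smul_apply, eval_smul]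
  rw [← taylor_coeff]
  have : taylor s ((X ^ 2 - 1 : ℝ[X]) ^ m) = X ^ m * (X + C (2 * s)) ^ m := by
    rw [taylor_pow, ← mul_pow]
    congr 1
    simp only [map_sub, taylor_pow, taylor_X, taylor_one, C_1]
    have : (C s ^ 2 : ℝ[X]) = 1 := by rw [← C_pow, hs, C_1]
    rw [C_mul]
    have h2 : (C 2 : ℝ[X]) = 2 := rfl
    rw [h2]
    linear_combination this
  rw [this]
  have := coeff_X_pow_mul ((X + C (2 * s) : ℝ[X]) ^ m) m 0
  rw [zero_add] at this
  rw [this, coeff_zero_eq_eval_zero]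
  simp only [eval_pow, eval_add, eval_X, eval_C, zero_add, nsmul_eq_mul, mul_pow]
  have : (Nat.factorial m : ℝ) ≠ 0 := by exact_mod_cast Nat.factorial_ne_zero m
  field_simp

open Polynomial in
theorem leg_norm (m : ℕ) :
    ∫ x in (-1:ℝ)..1, (legPoly m).eval x * (legPoly m).eval x = 2 / (2 * (m:ℝ) + 1) := by
  set p := legPoly m with hp
  have hpos : (2 * (m:ℝ) + 1) ≠ 0 := by positivity
  -- IBP with X * p and p
  have h1 := poly_ibp (X * p) p (-1) 1
  have e1 : p.eval 1 = 1 := by rw [hp, leg_endpt m 1 (by norm_num)]; simp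
  have e2 : p.eval (-1) * p.eval (-1) = 1 := by
    rw [hp, leg_endpt m (-1) (by norm_num), ← mul_pow]; simp
  -- the auxiliary polynomial
  have h2 : ∫ x in (-1:ℝ)..1, p.eval x * (X * derivative p - C (m:ℝ) * p).eval x = 0 := by
    rcases Nat.eq_zero_or_pos m with h0 | h0
    · subst h0
      have : derivative p = 0 := by
        have := legPoly_natDegree 0
        rw [← hp] at this
        rw [eq_C_of_natDegree_le_zero this]; simp
      simp [this]
    · apply leg_orth
      have hd := legPoly_natDegree m
      rw [← hp] at hd
      have : (X * derivative p - C (m:ℝ) * p).natDegree ≤ m - 1 := by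
        rw [natDegree_le_iff_coeff_eq_zero]
        intro N hN
        obtain ⟨n, rfl⟩ : ∃ n, N = n + 1 := ⟨N - 1, by omega⟩
        rw [coeff_sub, coeff_X_mul, coeff_derivative, coeff_C_mul]
        rcases Nat.lt_or_ge m (n+1) with h | h
        · rw [coeff_eq_zero_of_natDegree_lt (lt_of_le_of_lt hd h)]; ring
        · have : m = n + 1 := by omega
          rw [this]; push_cast; ring
      omega
  have h3 : ∫ x in (-1:ℝ)..1, p.eval x * (X * derivative p - C (m:ℝ) * p).eval x
      = (∫ x in (-1:ℝ)..1, (X * p).eval x * (derivative p).eval x)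
        - m * ∫ x in (-1:ℝ)..1, p.eval x * p.eval x := by
    rw [← intervalIntegral.integral_const_mul, ← intervalIntegral.integral_sub]
    · congr 1; funext x; simp; ring
    · exact poly_mul_intble _ _ _ _
    · exact (poly_mul_intble _ _ _ _).const_mul _
  have h4 : ∫ x in (-1:ℝ)..1, (derivative (X * p)).eval x * p.eval x
      = (∫ x in (-1:ℝ)..1, p.eval x * p.eval x)
        + ∫ x in (-1:ℝ)..1, (X * p).eval x * (derivative p).eval x := by
    rw [← intervalIntegral.integral_add (poly_mul_intble _ _ _ _) (poly_mul_intble _ _ _ _)]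
    congr 1; funext x; simp; ring
  rw [h4] at h1
  simp only [eval_mul, eval_X, e1] at h1 h3
  rw [h3] at h2
  rw [eq_div_iff hpos]
  linear_combination h1 + e2 - 2 * h2


/-- Legendre polynomial on the cell, as a polynomial. -/
noncomputable def Lc (a b : ℝ) (m : ℕ) : Polynomial ℝ :=
  (legPoly m).comp (Polynomial.C (2 / (b - a)) * Polynomial.X
    - Polynomial.C ((a + b) / (b - a)))

theorem Lc_eval (a b : ℝ) (m : ℕ) (x : ℝ) :
    (Lc a b m).eval x = (legPoly m).eval (2 / (b - a) * x - (a + b) / (b - a)) := by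
  simp [Lc]

theorem legendreCell_eq (m : ℕ) (a b x : ℝ) :
    legendreCell m a b x = (Lc a b m).eval x := by
  rw [Lc_eval, legendreCell, legendreP_eq]
  congr 1; ring

open Polynomial in
theorem Lc_natDegree (a b : ℝ) (m : ℕ) : (Lc a b m).natDegree ≤ m := by
  unfold Lc
  refine natDegree_comp_le.trans ?_
  have h1 := legPoly_natDegree m
  have h2 : (C (2 / (b - a)) * X - C ((a + b) / (b - a)) : ℝ[X]).natDegree ≤ 1 := by
    compute_degree
  calc _ ≤ m * 1 := Nat.mul_le_mul h1 h2
    _ = m := mul_one m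

theorem cell_subst {a b : ℝ} (hab : a < b) (f : ℝ → ℝ) :
    ∫ x in a..b, f (2 / (b - a) * x - (a + b) / (b - a))
      = (b - a) / 2 * ∫ s in (-1:ℝ)..1, f s := by
  have h : b - a ≠ 0 := by linarith
  rw [intervalIntegral.integral_comp_mul_sub f (c := 2 / (b - a)) (by positivity)
    ((a + b) / (b - a))]
  have e1 : 2 / (b - a) * a - (a + b) / (b - a) = -1 := by field_simp; ring
  have e2 : 2 / (b - a) * b - (a + b) / (b - a) = 1 := by field_simp; ring
  rw [e1, e2, smul_eq_mul, inv_div]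

open Polynomial in
theorem Lc_orth {a b : ℝ} (hab : a < b) (m : ℕ) (q : ℝ[X]) (hq : q.natDegree < m) :
    ∫ x in a..b, (Lc a b m).eval x * q.eval x = 0 := by
  have h : b - a ≠ 0 := by linarith
  set r : ℝ[X] := q.comp (C ((b - a) / 2) * X + C ((a + b) / 2)) with hr
  have hrd : r.natDegree < m := by
    refine lt_of_le_of_lt (natDegree_comp_le.trans ?_) hq
    have h2 : (C ((b - a) / 2) * X + C ((a + b) / 2) : ℝ[X]).natDegree ≤ 1 := by
      compute_degree
    calc _ ≤ q.natDegree * 1 := Nat.mul_le_mul le_rfl h2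
      _ = _ := mul_one _
  have h1 := cell_subst hab (fun s => (legPoly m).eval s * r.eval s)
  rw [leg_orth m r hrd, mul_zero] at h1
  rw [← h1]
  congr 1; funext x
  rw [Lc_eval, hr]
  simp only [eval_comp, eval_add, eval_mul, eval_C, eval_X]
  congr 2
  field_simp; ring

theorem Lc_right {a b : ℝ} (hab : a < b) (m : ℕ) : (Lc a b m).eval b = 1 := by
  have h : b - a ≠ 0 := by linarith
  rw [Lc_eval]
  have e2 : 2 / (b - a) * b - (a + b) / (b - a) = 1 := by field_simp; ring
  rw [e2, leg_endpt m 1 (by norm_num), one_pow]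

theorem Lc_norm {a b : ℝ} (hab : a < b) (m : ℕ) :
    ∫ x in a..b, (Lc a b m).eval x * (Lc a b m).eval x = (b - a) / (2 * (m:ℝ) + 1) := by
  simp only [Lc_eval]
  rw [cell_subst hab (fun s => (legPoly m).eval s * (legPoly m).eval s), leg_norm]
  field_simp

theorem Lc_orth' {a b : ℝ} (hab : a < b) (m n : ℕ) (hmn : m ≠ n) :
    ∫ x in a..b, (Lc a b m).eval x * (Lc a b n).eval x = 0 := by
  rcases lt_or_gt_of_ne hmn with h | h
  · rw [← Lc_orth hab n _ (lt_of_le_of_lt (Lc_natDegree a b m) h)]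
    congr 1; funext x; ring
  · exact Lc_orth hab m _ (lt_of_le_of_lt (Lc_natDegree a b n) h)

theorem Lc_coeff_ne {a b : ℝ} (hab : a < b) (m : ℕ) : (Lc a b m).coeff m ≠ 0 := by
  intro h
  have hn := Lc_norm hab m
  have hpos : 0 < (b - a) / (2 * (m:ℝ) + 1) := div_pos (by linarith) (by positivity)
  have hd := Lc_natDegree a b m
  by_cases h0 : (Lc a b m).natDegree < m
  · rw [Lc_orth hab m _ h0] at hn; linarith
  · have : (Lc a b m).natDegree = m := by omega
    have h2 : (Lc a b m) = 0 := by
      rw [← Polynomial.leadingCoeff_eq_zero, Polynomial.leadingCoeff, this, h]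
    rw [h2] at hn
    simp only [Polynomial.eval_zero, mul_zero, intervalIntegral.integral_zero] at hn
    linarith

open Polynomial in
theorem Lc_span {a b : ℝ} (hab : a < b) (n : ℕ) (q : ℝ[X]) (hq : q.natDegree ≤ n) :
    ∃ c : ℕ → ℝ, q = ∑ m ∈ Finset.range (n + 1), C (c m) * Lc a b m := by
  induction n generalizing q with
  | zero =>
    have h0 := Lc_coeff_ne hab 0
    refine ⟨fun _ => q.coeff 0 / (Lc a b 0).coeff 0, ?_⟩
    rw [eq_C_of_natDegree_le_zero hq]
    have := eq_C_of_natDegree_le_zero (Lc_natDegree a b 0)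
    simp only [zero_add, Finset.range_one, Finset.sum_singleton]
    conv_rhs => rw [this]
    rw [← C_mul]
    simp [h0]
  | succ n ih =>
    have h0 := Lc_coeff_ne hab (n+1)
    set d := q.coeff (n+1) / (Lc a b (n+1)).coeff (n+1) with hd
    obtain ⟨c, hc⟩ := ih (q - C d * Lc a b (n+1)) (by
      rw [natDegree_le_iff_coeff_eq_zero]
      intro N hN
      rw [coeff_sub, coeff_C_mul]
      rcases Nat.lt_or_ge (n+1) N with h | h
      · rw [coeff_eq_zero_of_natDegree_lt (lt_of_le_of_lt hq h),
          coeff_eq_zero_of_natDegree_lt (lt_of_le_of_lt (Lc_natDegree a b (n+1)) h)]; simp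
      · have : N = n + 1 := by omega
        rw [this, hd]; field_simp; simp)
    refine ⟨fun m => if m = n + 1 then d else c m, ?_⟩
    rw [Finset.sum_range_succ]
    simp only [if_true]
    have : ∑ m ∈ Finset.range (n + 1), C (if m = n + 1 then d else c m) * Lc a b m
        = ∑ m ∈ Finset.range (n + 1), C (c m) * Lc a b m := by
      apply Finset.sum_congr rfl
      intro m hm
      rw [Finset.mem_range] at hm
      rw [if_neg (by omega)]
    rw [this, ← hc]; ring

open Polynomial in
theorem Lc_expand {a b : ℝ} (hab : a < b) (n : ℕ) (q : ℝ[X]) (hq : q.natDegree ≤ n) (y : ℝ) :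
    q.eval y = ∑ m ∈ Finset.range (n + 1),
      (2 * (m:ℝ) + 1) / (b - a) * (∫ x in a..b, q.eval x * (Lc a b m).eval x)
        * (Lc a b m).eval y := by
  have h : b - a ≠ 0 := by linarith
  obtain ⟨c, hc⟩ := Lc_span hab n q hq
  have key : ∀ m ∈ Finset.range (n+1),
      ∫ x in a..b, q.eval x * (Lc a b m).eval x = c m * ((b - a) / (2 * (m:ℝ) + 1)) := by
    intro m hm
    have e : ∀ x, q.eval x * (Lc a b m).eval x = ∑ l ∈ Finset.range (n + 1),
        c l * ((Lc a b l).eval x * (Lc a b m).eval x) := by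
      intro x
      conv_lhs => rw [hc]
      rw [eval_finsetSum, Finset.sum_mul]
      simp [mul_assoc]
    simp only [e]
    rw [intervalIntegral.integral_finsetSum
      (fun l _ => (poly_mul_intble _ _ _ _).const_mul _)]
    simp only [intervalIntegral.integral_const_mul]
    rw [Finset.sum_eq_single m]
    · rw [Lc_norm hab]
    · intro l _ hl
      rw [Lc_orth' hab l m hl, mul_zero]
    · intro hm'; exact absurd hm hm'
  conv_lhs => rw [hc]
  rw [eval_finsetSum]
  apply Finset.sum_congr rfl
  intro m hm
  rw [key m hm, eval_mul, eval_C]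
  have : (2 * (m:ℝ) + 1) ≠ 0 := by positivity
  field_simp

theorem leg_bound (m : ℕ) : ∃ B : ℝ, 1 ≤ B ∧ ∀ a b : ℝ, a < b → ∀ x ∈ Set.Icc a b,
    |(Lc a b m).eval x| ≤ B := by
  obtain ⟨B, hB⟩ := (isCompact_Icc (a := (-1:ℝ)) (b := 1)).exists_bound_of_continuousOn
    ((legPoly m).continuous.continuousOn)
  refine ⟨max B 1, le_max_right _ _, fun a b hab x hx => ?_⟩
  have h : 0 < b - a := by linarith
  rw [Lc_eval]
  refine le_trans ?_ (le_max_left _ _)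
  apply hB
  have e : 2 / (b - a) * x - (a + b) / (b - a) = (2 * x - (a + b)) / (b - a) := by ring
  rw [e]
  constructor
  · rw [le_div_iff₀ h]; linarith [hx.1]
  · rw [div_le_iff₀ h]; linarith [hx.2]

theorem leg_bound_all (n : ℕ) : ∃ B : ℝ, 1 ≤ B ∧ ∀ m ≤ n, ∀ a b : ℝ, a < b →
    ∀ x ∈ Set.Icc a b, |(Lc a b m).eval x| ≤ B := by
  choose B hB1 hB using leg_bound
  refine ⟨∑ m ∈ Finset.range (n+1), B m, ?_, ?_⟩
  · refine (hB1 0).trans ?_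
    exact Finset.single_le_sum (f := B) (fun i _ => by linarith [hB1 i]) (by simp)
  · intro m hm a b hab x hx
    refine (hB m a b hab x hx).trans ?_
    exact Finset.single_le_sum (f := B) (fun i _ => by linarith [hB1 i])
      (Finset.mem_range.2 (by omega))


theorem gr_formula {a b : ℝ} (hab : a < b) {k : ℕ} {u : ℝ → ℝ} {P : Polynomial ℝ}
    (hP : IsGRProj k a b u P) (y : ℝ) :
    P.eval y = (∑ m ∈ Finset.range k,
      (2 * (m:ℝ) + 1) / (b - a) * (∫ x in a..b, u x * (Lc a b m).eval x)
        * ((Lc a b m).eval y - (Lc a b k).eval y)) + u b * (Lc a b k).eval y := by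
  obtain ⟨hd, hm, hb⟩ := hP
  have key : ∀ m ∈ Finset.range k, ∫ x in a..b, P.eval x * (Lc a b m).eval x
      = ∫ x in a..b, u x * (Lc a b m).eval x := by
    intro m hmk
    rw [Finset.mem_range] at hmk
    exact hm _ (by have := Lc_natDegree a b m; omega)
  have hy := Lc_expand hab k P hd y
  have hbb := Lc_expand hab k P hd b
  rw [Finset.sum_range_succ] at hy hbb
  simp only [Lc_right hab, mul_one, hb] at hbb
  rw [Finset.sum_congr rfl (fun m h => by rw [key m h])] at hy hbb
  rw [hy]
  simp only [mul_sub]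
  rw [Finset.sum_sub_distrib, ← Finset.sum_mul, hbb]
  ring

/-- stability constant -/
noncomputable def stabC (k : ℕ) (B : ℝ) : ℝ :=
  (∑ m ∈ Finset.range k, (2 * (m:ℝ) + 1) * (2 * B * B)) + B

theorem stabC_nonneg (k : ℕ) {B : ℝ} (hB : 1 ≤ B) : 0 ≤ stabC k B := by
  unfold stabC
  have : 0 ≤ B := by linarith
  positivity

theorem moment_bound {a b : ℝ} (hab : a < b) {u : ℝ → ℝ} {S B : ℝ} (q : Polynomial ℝ)
    (hS : ∀ x ∈ Set.Icc a b, |u x| ≤ S) (hq : ∀ x ∈ Set.Icc a b, |q.eval x| ≤ B) :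
    |∫ x in a..b, u x * q.eval x| ≤ S * B * (b - a) := by
  have := intervalIntegral.norm_integral_le_of_norm_le_const (a := a) (b := b)
    (f := fun x => u x * q.eval x) (C := S * B) (by
      intro x hx
      rw [Set.uIoc_of_le hab.le] at hx
      have hx' : x ∈ Set.Icc a b := ⟨hx.1.le, hx.2⟩
      rw [Real.norm_eq_abs, abs_mul]
      exact mul_le_mul (hS x hx') (hq x hx') (abs_nonneg _) ((abs_nonneg _).trans (hS x hx')))
  rwa [Real.norm_eq_abs, abs_of_pos (by linarith : 0 < b - a)] at this

theorem gr_stable {a b : ℝ} (hab : a < b) {k : ℕ} {u : ℝ → ℝ} {P : Polynomial ℝ}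
    (hP : IsGRProj k a b u P) {B S : ℝ} (hB1 : 1 ≤ B)
    (hB : ∀ m ≤ k, ∀ x ∈ Set.Icc a b, |(Lc a b m).eval x| ≤ B)
    (hS : ∀ x ∈ Set.Icc a b, |u x| ≤ S) {y : ℝ} (hy : y ∈ Set.Icc a b) :
    |P.eval y| ≤ stabC k B * S := by
  have hba : 0 < b - a := by linarith
  have hS0 : 0 ≤ S := (abs_nonneg _).trans (hS b ⟨hab.le, le_rfl⟩)
  rw [gr_formula hab hP y, stabC, add_mul, Finset.sum_mul]
  refine (abs_add_le _ _).trans (add_le_add ?_ ?_)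
  · refine (Finset.abs_sum_le_sum_abs _ _).trans (Finset.sum_le_sum ?_)
    intro m hm
    rw [Finset.mem_range] at hm
    rw [abs_mul, abs_mul]
    have h1 := moment_bound hab (Lc a b m) hS (hB m hm.le)
    have h2 : |(Lc a b m).eval y - (Lc a b k).eval y| ≤ 2 * B :=
      (abs_sub _ _).trans (by linarith [hB m hm.le y hy, hB k le_rfl y hy])
    have h3 : |(2 * (m:ℝ) + 1) / (b - a)| = (2 * (m:ℝ) + 1) / (b - a) :=
      abs_of_nonneg (by positivity)
    rw [h3]
    calc _ ≤ (2 * (m:ℝ) + 1) / (b - a) * (S * B * (b - a)) * (2 * B) := by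
            gcongr
      _ = _ := by field_simp
  · rw [abs_mul, mul_comm]
    exact mul_le_mul (hB k le_rfl y hy) (hS b ⟨hab.le, le_rfl⟩) (abs_nonneg _) (by linarith)

theorem radau_formula {a b : ℝ} {u : ℝ → ℝ} (hu : Continuous u) (n : ℕ) :
    radauCoeff a b u n = u b - ∑ m ∈ Finset.range n,
      (2 * (m:ℝ) + 1) / (b - a) * ∫ x in a..b, u x * (Lc a b m).eval x := by
  unfold radauCoeff
  congr 1
  simp only [legendreCell_eq, Finset.mul_sum]
  rw [intervalIntegral.integral_finsetSum]
  · rw [Finset.mul_sum]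
    apply Finset.sum_congr rfl
    intro m _
    have : ∀ x, u x * ((2 * (m:ℝ) + 1) * (Lc a b m).eval x)
      = (2 * (m:ℝ) + 1) * (u x * (Lc a b m).eval x) := fun x => by ring
    simp only [this]
    rw [intervalIntegral.integral_const_mul]
    ring
  · intro m _
    apply Continuous.intervalIntegrable
    have := (Lc a b m).continuous
    fun_prop

theorem gr_moment {a b : ℝ} (hab : a < b) {k : ℕ} {u : ℝ → ℝ} (hu : Continuous u)
    {P : Polynomial ℝ} (hP : IsGRProj k a b u P) (v : Polynomial ℝ) (hv : v.natDegree ≤ k) :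
    ∫ x in a..b, P.eval x * v.eval x = (∫ x in a..b, u x * v.eval x)
      + radauCoeff a b u (k + 1) * ∫ x in a..b, (Lc a b k).eval x * v.eval x := by
  have hba : b - a ≠ 0 := by linarith
  obtain ⟨hd, hm, hb⟩ := hP
  have key : ∀ m ∈ Finset.range k, ∫ x in a..b, P.eval x * (Lc a b m).eval x
      = ∫ x in a..b, u x * (Lc a b m).eval x := by
    intro m hmk
    rw [Finset.mem_range] at hmk
    exact hm _ (by have := Lc_natDegree a b m; omega)
  -- case v = L_k
  have hLk : ∫ x in a..b, P.eval x * (Lc a b k).eval x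
      = (∫ x in a..b, u x * (Lc a b k).eval x)
        + radauCoeff a b u (k + 1) * ((b - a) / (2 * (k:ℝ) + 1)) := by
    have hbb := Lc_expand hab k P hd b
    rw [Finset.sum_range_succ] at hbb
    simp only [Lc_right hab, mul_one, hb] at hbb
    rw [Finset.sum_congr rfl (fun m h => by rw [key m h])] at hbb
    rw [radau_formula hu, Finset.sum_range_succ, hbb]
    have : (2 * (k:ℝ) + 1) ≠ 0 := by positivity
    field_simp
    ring
  obtain ⟨c, hc⟩ := Lc_span hab k v hv
  have hbil : ∀ f : ℝ → ℝ, Continuous f → ∫ x in a..b, f x * v.eval x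
      = ∑ m ∈ Finset.range (k+1), c m * ∫ x in a..b, f x * (Lc a b m).eval x := by
    intro f hf
    have e : ∀ x, f x * v.eval x = ∑ m ∈ Finset.range (k+1),
        c m * (f x * (Lc a b m).eval x) := by
      intro x
      conv_lhs => rw [hc]
      rw [Polynomial.eval_finsetSum, Finset.mul_sum]
      apply Finset.sum_congr rfl
      intro m _
      simp; ring
    simp only [e]
    rw [intervalIntegral.integral_finsetSum]
    · simp only [intervalIntegral.integral_const_mul]
    · intro m _
      apply Continuous.intervalIntegrable
      have := (Lc a b m).continuous
      fun_prop
  rw [hbil _ P.continuous, hbil _ hu, hbil _ (Lc a b k).continuous]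
  simp only [Finset.sum_range_succ]
  rw [Finset.sum_congr rfl (fun m h => by rw [key m h]), hLk, Lc_norm hab]
  have : ∑ m ∈ Finset.range k, c m * ∫ x in a..b, (Lc a b k).eval x * (Lc a b m).eval x = 0 := by
    apply Finset.sum_eq_zero
    intro m hm
    rw [Finset.mem_range] at hm
    rw [Lc_orth' hab k m (by omega), mul_zero]
  rw [this]
  ring

/-- radau coefficient constant -/
noncomputable def radC (k : ℕ) (B : ℝ) : ℝ :=
  1 + ∑ m ∈ Finset.range (k+1), (2 * (m:ℝ) + 1) * B

theorem radC_nonneg (k : ℕ) {B : ℝ} (hB : 1 ≤ B) : 0 ≤ radC k B := by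
  unfold radC
  have : 0 ≤ B := by linarith
  positivity

theorem radau_stable {a b : ℝ} (hab : a < b) {k : ℕ} {u : ℝ → ℝ} (hu : Continuous u)
    {B S : ℝ} 
    (hB : ∀ m ≤ k, ∀ x ∈ Set.Icc a b, |(Lc a b m).eval x| ≤ B)
    (hS : ∀ x ∈ Set.Icc a b, |u x| ≤ S) :
    |radauCoeff a b u (k+1)| ≤ radC k B * S := by
  have hba : 0 < b - a := by linarith
  rw [radau_formula hu, radC, add_mul, one_mul, Finset.sum_mul]
  refine (abs_sub _ _).trans (add_le_add (hS b ⟨hab.le, le_rfl⟩) ?_)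
  refine (Finset.abs_sum_le_sum_abs _ _).trans (Finset.sum_le_sum ?_)
  intro m hm
  rw [Finset.mem_range] at hm
  have h1 := moment_bound hab (Lc a b m) hS (hB m (by omega))
  have h3 : |(2 * (m:ℝ) + 1) / (b - a)| = (2 * (m:ℝ) + 1) / (b - a) :=
      abs_of_nonneg (by positivity)
  rw [abs_mul, h3]
  calc _ ≤ (2 * (m:ℝ) + 1) / (b - a) * (S * B * (b - a)) := by gcongr
      _ = _ := by field_simp

theorem radau_poly {a b : ℝ} (hab : a < b) {k : ℕ} (q : Polynomial ℝ) (hq : q.natDegree ≤ k) :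
    radauCoeff a b (fun x => q.eval x) (k+1) = 0 := by
  rw [radau_formula q.continuous]
  have := Lc_expand hab k q hq b
  simp only [Lc_right hab, mul_one] at this
  rw [sub_eq_zero]; exact this

theorem radau_sub {a b : ℝ} {u v : ℝ → ℝ} (hu : Continuous u) (hv : Continuous v) (n : ℕ) :
    radauCoeff a b (fun x => u x - v x) n = radauCoeff a b u n - radauCoeff a b v n := by
  rw [radau_formula hu, radau_formula hv, radau_formula (u := fun x => u x - v x) (hu.sub hv)]
  have : ∀ m, ∫ x in a..b, (u x - v x) * (Lc a b m).eval x
      = (∫ x in a..b, u x * (Lc a b m).eval x) - ∫ x in a..b, v x * (Lc a b m).eval x := by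
    intro m
    have := (Lc a b m).continuous
    rw [← intervalIntegral.integral_sub]
    · simp only [sub_mul]
    · apply Continuous.intervalIntegrable; fun_prop
    · apply Continuous.intervalIntegrable; fun_prop
  simp only [this, mul_sub, Finset.sum_sub_distrib]
  ring

theorem taylor_poly {a b : ℝ} (hab : a < b) {f : ℝ → ℝ} {n : ℕ} (hf : ContDiff ℝ (n+1) f)
    {S : ℝ} (hS : ∀ x ∈ Set.Icc a b, |iteratedDeriv (n+1) f x| ≤ S) :
    ∃ q : Polynomial ℝ, q.natDegree ≤ n ∧
      ∀ x ∈ Set.Icc a b, |f x - q.eval x| ≤ S * (b - a) ^ (n+1) := by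
  have hS0 : 0 ≤ S := (abs_nonneg _).trans (hS b ⟨hab.le, le_rfl⟩)
  refine ⟨∑ i ∈ Finset.range (n+1), Polynomial.C ((Nat.factorial i : ℝ)⁻¹ *
    iteratedDerivWithin i f (Set.Icc a b) a) * (Polynomial.X - Polynomial.C a) ^ i, ?_, ?_⟩
  · apply Polynomial.natDegree_sum_le_of_forall_le
    intro i hi
    rw [Finset.mem_range] at hi
    refine (Polynomial.natDegree_C_mul_le _ _).trans ?_
    refine (Polynomial.natDegree_pow_le_of_le (m := 1) i ?_).trans (by omega)
    compute_degree
  · intro x hx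
    have h := taylor_mean_remainder_bound (n := n) (C := S) hab.le
      (by exact_mod_cast hf.contDiffOn) hx (by
        intro y hy
        rw [iteratedDerivWithin_eq_iteratedDeriv (uniqueDiffOn_Icc hab)
          (by exact_mod_cast hf.contDiffAt) hy]
        exact hS y hy)
    rw [taylor_within_apply] at h
    have e : (∑ i ∈ Finset.range (n+1), Polynomial.C ((Nat.factorial i : ℝ)⁻¹ *
      iteratedDerivWithin i f (Set.Icc a b) a) * (Polynomial.X - Polynomial.C a) ^ i).eval x
      = ∑ i ∈ Finset.range (n+1), ((Nat.factorial i : ℝ)⁻¹ * (x - a) ^ i) •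
        iteratedDerivWithin i f (Set.Icc a b) a := by
      rw [Polynomial.eval_finsetSum]
      apply Finset.sum_congr rfl
      intro i _
      simp; ring
    rw [e]
    refine h.trans ?_
    have hfac : (1:ℝ) ≤ Nat.factorial n := by exact_mod_cast Nat.factorial_pos n
    refine (div_le_self (mul_nonneg hS0 (pow_nonneg (by linarith [hx.1]) _)) hfac).trans ?_
    have : 0 ≤ x - a := by linarith [hx.1]
    gcongr
    exact hx.2

theorem radau_bound {a b : ℝ} (hab : a < b) {k : ℕ} {u : ℝ → ℝ} (hu : ContDiff ℝ (k+1) u)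
    {B S : ℝ} 
    (hB : ∀ m ≤ k, ∀ x ∈ Set.Icc a b, |(Lc a b m).eval x| ≤ B)
    (hS : ∀ x ∈ Set.Icc a b, |iteratedDeriv (k+1) u x| ≤ S) :
    |radauCoeff a b u (k+1)| ≤ radC k B * (S * (b - a) ^ (k+1)) := by
  obtain ⟨q, hqd, hq⟩ := taylor_poly hab hu hS
  have h1 := radau_stable hab (u := fun x => u x - q.eval x)
    (hu.continuous.sub q.continuous) hB hq
  rwa [radau_sub hu.continuous q.continuous, radau_poly hab q hqd, sub_zero] at h1

theorem gr_radau_pt {a b : ℝ} (hab : a < b) {k : ℕ} {u : ℝ → ℝ}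
    (hu : ContDiff ℝ (k+2) u) {P : Polynomial ℝ} (hP : IsGRProj k a b u P)
    {B S : ℝ} (hB1 : 1 ≤ B)
    (hB : ∀ m ≤ k, ∀ x ∈ Set.Icc a b, |(Lc a b m).eval x| ≤ B)
    (hS : ∀ x ∈ Set.Icc a b, |iteratedDeriv (k+2) u x| ≤ S)
    {r : ℝ} (hr : r ∈ Set.Icc a b) (hroot : (Lc a b (k+1)).eval r - (Lc a b k).eval r = 0) :
    |u r - P.eval r| ≤ (1 + stabC k B) * (S * (b - a) ^ (k+2)) := by
  obtain ⟨q, hqd, hq⟩ := taylor_poly (n := k+1) hab (by exact_mod_cast hu) hS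
  have h0 := Lc_coeff_ne hab (k+1)
  set d := q.coeff (k+1) / (Lc a b (k+1)).coeff (k+1) with hd
  set D : Polynomial ℝ := Polynomial.C d * (Lc a b (k+1) - Lc a b k) with hD
  -- `q - D` has degree at most `k`
  have hdeg : (q - D).natDegree ≤ k := by
    rw [Polynomial.natDegree_le_iff_coeff_eq_zero]
    intro N hN
    have hk0 : (Lc a b k).coeff N = 0 :=
      Polynomial.coeff_eq_zero_of_natDegree_lt (lt_of_le_of_lt (Lc_natDegree a b k) hN)
    rw [Polynomial.coeff_sub, hD, Polynomial.coeff_C_mul, Polynomial.coeff_sub, hk0]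
    rcases Nat.lt_or_ge (k+1) N with h | h
    · rw [Polynomial.coeff_eq_zero_of_natDegree_lt (lt_of_le_of_lt hqd h),
        Polynomial.coeff_eq_zero_of_natDegree_lt
          (lt_of_le_of_lt (Lc_natDegree a b (k+1)) h)]; simp
    · have : N = k + 1 := by omega
      rw [this, hd]; field_simp; simp
  have hG : IsGRProj k a b (fun x => u x - q.eval x) (P - (q - D)) := by
    obtain ⟨hPd, hPm, hPb⟩ := hP
    refine ⟨(Polynomial.natDegree_sub_le _ _).trans (max_le hPd hdeg), ?_, ?_⟩
    · intro v hv
      have e1 : ∫ x in a..b, (P - (q - D)).eval x * v.eval x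
          = (∫ x in a..b, P.eval x * v.eval x) - (∫ x in a..b, q.eval x * v.eval x)
            + d * (∫ x in a..b, (Lc a b (k+1)).eval x * v.eval x)
            - d * (∫ x in a..b, (Lc a b k).eval x * v.eval x) := by
        rw [← intervalIntegral.integral_const_mul, ← intervalIntegral.integral_const_mul,
          ← intervalIntegral.integral_sub (poly_mul_intble _ _ _ _) (poly_mul_intble _ _ _ _),
          ← intervalIntegral.integral_add ((poly_mul_intble _ _ _ _).sub (poly_mul_intble _ _ _ _))
            ((poly_mul_intble _ _ _ _).const_mul _),
          ← intervalIntegral.integral_sub (((poly_mul_intble _ _ _ _).sub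
            (poly_mul_intble _ _ _ _)).add ((poly_mul_intble _ _ _ _).const_mul _))
            ((poly_mul_intble _ _ _ _).const_mul _)]
        congr 1; funext x
        simp [hD]; ring
      have e2 : ∫ x in a..b, (u x - q.eval x) * v.eval x
          = (∫ x in a..b, u x * v.eval x) - (∫ x in a..b, q.eval x * v.eval x) := by
        rw [← intervalIntegral.integral_sub _ (poly_mul_intble _ _ _ _)]
        · congr 1; funext x; ring
        · exact (hu.continuous.mul v.continuous).intervalIntegrable _ _
      rw [e1, e2, Lc_orth hab _ v (by omega), Lc_orth hab _ v (by omega), hPm v hv]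
      ring
    · simp [hD, Lc_right hab, hPb]
  have hst := gr_stable hab hG hB1 hB hq hr
  have hDr : D.eval r = 0 := by
    rw [hD]; simp only [Polynomial.eval_mul, Polynomial.eval_sub]; rw [hroot, mul_zero]
  have e : u r - P.eval r = (u r - q.eval r) - (P - (q - D)).eval r := by
    simp only [Polynomial.eval_sub, hDr]; ring
  rw [e, add_mul, one_mul]
  exact (abs_sub _ _).trans (add_le_add (hq r hr) hst)


theorem dinv_hasDeriv (a b : ℝ) (p : Polynomial ℝ) (x : ℝ) :
    HasDerivAt (Dinv a b (fun x => p.eval x)) (2 / (b - a) * p.eval x) x := by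
  unfold Dinv
  exact (intervalIntegral.integral_hasDerivAt_right (p.continuous.intervalIntegrable _ _)
    (p.continuous.stronglyMeasurableAtFilter _ _) p.continuous.continuousAt).const_mul _

theorem dinv_right {a b : ℝ} {p : Polynomial ℝ} (h0 : ∫ x in a..b, p.eval x = 0) :
    Dinv a b (fun x => p.eval x) b = 0 := by
  simp [Dinv, h0]

theorem dinv_ibp {a b : ℝ} {p : Polynomial ℝ} (h0 : ∫ x in a..b, p.eval x = 0)
    (v : Polynomial ℝ) :
    ∫ x in a..b, Dinv a b (fun x => p.eval x) x * v.derivative.eval x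
      = -(2 / (b - a)) * ∫ x in a..b, p.eval x * v.eval x := by
  have := integral_mul_deriv_eq_deriv_mul (a := a) (b := b)
    (u := Dinv a b (fun x => p.eval x)) (v := fun x => v.eval x)
    (u' := fun x => 2 / (b - a) * p.eval x) (v' := fun x => v.derivative.eval x)
    (fun x _ => dinv_hasDeriv a b p x) (fun x _ => v.hasDerivAt x)
    ((poly_intble _ a b).const_mul _) (poly_intble _ a b)
  rw [this, dinv_right h0]
  have : Dinv a b (fun x => p.eval x) a = 0 := by simp [Dinv]
  rw [this, ← intervalIntegral.integral_const_mul]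
  simp only [mul_assoc, neg_mul, intervalIntegral.integral_neg]
  ring

theorem dinv_bound {a b : ℝ} (hab : a < b) {p : Polynomial ℝ} {S : ℝ}
    (hS : ∀ x ∈ Set.Icc a b, |p.eval x| ≤ S) {x : ℝ} (hx : x ∈ Set.Icc a b) :
    |Dinv a b (fun x => p.eval x) x| ≤ 2 * S := by
  have hba : 0 < b - a := by linarith
  have hS0 : 0 ≤ S := (abs_nonneg _).trans (hS b ⟨hab.le, le_rfl⟩)
  have := intervalIntegral.norm_integral_le_of_norm_le_const (a := a) (b := x)
    (f := fun x => p.eval x) (C := S) (by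
      intro y hy
      rw [Set.uIoc_of_le hx.1] at hy
      exact hS y ⟨hy.1.le, hy.2.trans hx.2⟩)
  rw [Real.norm_eq_abs, abs_of_nonneg (by linarith [hx.1] : 0 ≤ x - a)] at this
  unfold Dinv
  rw [abs_mul, abs_of_pos (by positivity : 0 < 2 / (b - a))]
  calc _ ≤ 2 / (b - a) * (S * (b - a)) := by
        gcongr
        refine this.trans ?_
        gcongr
        exact hx.2
    _ = 2 * S := by field_simp

theorem legendreCell_fun (k : ℕ) (a b : ℝ) :
    legendreCell k a b = fun x => (Lc a b k).eval x := by
  funext x; exact legendreCell_eq k a b x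

theorem natDegree_deriv_ok {k : ℕ} (hk : 1 ≤ k) {v : Polynomial ℝ} (hv : v.natDegree ≤ k) :
    v.derivative.natDegree + 1 ≤ k := by
  have := Polynomial.natDegree_derivative_le v
  omega

theorem Lc_int_zero {a b : ℝ} (hab : a < b) {k : ℕ} (hk : 1 ≤ k) :
    ∫ x in a..b, (Lc a b k).eval x = 0 := by
  have := Lc_orth hab k 1 (by simp; omega)
  simpa using this

theorem F1_ibp {a b : ℝ} (hab : a < b) {k : ℕ} (hk : 2 ≤ k) {F : ℕ → Polynomial ℝ}
    (hF : IsFSeq k a b F) (v : Polynomial ℝ) (hv : v.natDegree ≤ k) :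
    ∫ x in a..b, (F 1).eval x * v.derivative.eval x
      = -(2 / (b - a)) * ∫ x in a..b, (Lc a b k).eval x * v.eval x := by
  obtain ⟨⟨hd, hm, hb⟩, -⟩ := hF
  rw [hm _ (natDegree_deriv_ok (by omega) hv), legendreCell_fun,
    dinv_ibp (Lc_int_zero hab (by omega))]

theorem F1_right {a b : ℝ} (hab : a < b) {k : ℕ} (hk : 2 ≤ k) {F : ℕ → Polynomial ℝ}
    (hF : IsFSeq k a b F) : (F 1).eval b = 0 := by
  obtain ⟨⟨hd, hm, hb⟩, -⟩ := hF
  rw [hb, legendreCell_fun, dinv_right (Lc_int_zero hab (by omega))]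

theorem F1_int {a b : ℝ} (hab : a < b) {k : ℕ} (hk : 2 ≤ k) {F : ℕ → Polynomial ℝ}
    (hF : IsFSeq k a b F) : ∫ x in a..b, (F 1).eval x = 0 := by
  have h := F1_ibp hab hk hF Polynomial.X (by simp; omega)
  rw [Lc_orth hab k Polynomial.X (by simp; omega)] at h
  simpa using h

theorem F2_gr {a b : ℝ} {k : ℕ} {F : ℕ → Polynomial ℝ}
    (hF : IsFSeq k a b F) : IsGRProj k a b (Dinv a b (fun x => (F 1).eval x)) (-(F 2)) :=
  hF.2 2 le_rfl

theorem F2_right {a b : ℝ} (hab : a < b) {k : ℕ} (hk : 2 ≤ k) {F : ℕ → Polynomial ℝ}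
    (hF : IsFSeq k a b F) : (F 2).eval b = 0 := by
  have h := (F2_gr hF).2.2
  rw [dinv_right (F1_int hab hk hF)] at h
  simpa using h

theorem F2_ibp {a b : ℝ} (hab : a < b) {k : ℕ} (hk : 2 ≤ k) {F : ℕ → Polynomial ℝ}
    (hF : IsFSeq k a b F) (v : Polynomial ℝ) (hv : v.natDegree ≤ k) :
    ∫ x in a..b, (F 2).eval x * v.derivative.eval x
      = (2 / (b - a)) * ∫ x in a..b, (F 1).eval x * v.eval x := by
  have h := (F2_gr hF).2.1 _ (natDegree_deriv_ok (by omega) hv)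
  rw [dinv_ibp (F1_int hab hk hF)] at h
  simp only [Polynomial.eval_neg, neg_mul, intervalIntegral.integral_neg] at h
  linarith

theorem F1_bound {a b : ℝ} (hab : a < b) {k : ℕ} {F : ℕ → Polynomial ℝ}
    (hF : IsFSeq k a b F) {B : ℝ} (hB1 : 1 ≤ B)
    (hB : ∀ m ≤ k, ∀ x ∈ Set.Icc a b, |(Lc a b m).eval x| ≤ B)
    {y : ℝ} (hy : y ∈ Set.Icc a b) : |(F 1).eval y| ≤ stabC k B * (2 * B) := by
  have h := hF.1
  rw [legendreCell_fun] at h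
  exact gr_stable hab h hB1 hB (fun x hx => dinv_bound hab (hB k le_rfl) hx) hy

theorem F2_bound {a b : ℝ} (hab : a < b) {k : ℕ} {F : ℕ → Polynomial ℝ}
    (hF : IsFSeq k a b F) {B : ℝ} (hB1 : 1 ≤ B)
    (hB : ∀ m ≤ k, ∀ x ∈ Set.Icc a b, |(Lc a b m).eval x| ≤ B)
    {y : ℝ} (hy : y ∈ Set.Icc a b) :
    |(F 2).eval y| ≤ stabC k B * (2 * (stabC k B * (2 * B))) := by
  have := gr_stable hab (F2_gr hF) hB1 hB
    (fun x hx => dinv_bound hab (fun z hz => F1_bound hab hF hB1 hB hz) hx) hy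
  simpa using this

/-! ### time derivatives -/

theorem hasDerivAt_moment (a b : ℝ) {f g : ℝ → ℝ} (hf : ContDiff ℝ 1 f) (hg : Continuous g)
    (t : ℝ) : HasDerivAt (fun s => ∫ y in a..b, f (y - s) * g y)
      (∫ y in a..b, -(deriv f (y - t)) * g y) t := by
  have hf' : Continuous (deriv f) := hf.continuous_deriv le_rfl
  have hfc := hf.continuous
  obtain ⟨K, hK⟩ := ((isCompact_Icc (a := t - 1) (b := t + 1)).prod
    (isCompact_uIcc (a := a) (b := b))).exists_bound_of_continuousOn
    (f := fun z : ℝ × ℝ => -(deriv f (z.2 - z.1)) * g z.2) (by fun_prop)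
  refine (intervalIntegral.hasDerivAt_integral_of_dominated_loc_of_deriv_le (𝕜 := ℝ)
    (F := fun s y => f (y - s) * g y) (F' := fun s y => -(deriv f (y - s)) * g y)
    (s := Set.Icc (t-1) (t+1)) (bound := fun _ => K)
    (Icc_mem_nhds (by linarith) (by linarith)) ?_ ?_ ?_ ?_ ?_ ?_).2
  · refine Filter.Eventually.of_forall fun s => ?_
    apply Continuous.aestronglyMeasurable
    fun_prop
  · apply Continuous.intervalIntegrable; fun_prop
  · apply Continuous.aestronglyMeasurable
    fun_prop
  · refine Filter.Eventually.of_forall fun y hy s hs => ?_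
    exact hK (s, y) ⟨hs, Set.uIoc_subset_uIcc hy⟩
  · exact intervalIntegrable_const
  · refine Filter.Eventually.of_forall fun y hy s hs => ?_
    apply HasDerivAt.mul_const
    have h1 : HasDerivAt f (deriv f (y - s)) (y - s) :=
      (hf.differentiable (by norm_num) _).hasDerivAt
    have h2 : HasDerivAt (fun s => y - s) (-1) s := by
      simpa using (hasDerivAt_id s).const_sub y
    have := h1.comp s h2
    simpa [Function.comp_def] using this

theorem hasDerivAt_shift {f : ℝ → ℝ} (hf : ContDiff ℝ 1 f) (y t : ℝ) :
    HasDerivAt (fun s => f (y - s)) (-(deriv f (y - t))) t := by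
  have h1 : HasDerivAt f (deriv f (y - t)) (y - t) :=
      (hf.differentiable (by norm_num) _).hasDerivAt
  have h2 : HasDerivAt (fun s => y - s) (-1) t := by
    simpa using (hasDerivAt_id t).const_sub y
  have := h1.comp t h2
  simpa [Function.comp_def] using this

theorem hasDerivAt_radau (a b : ℝ) (n : ℕ) {f : ℝ → ℝ} (hf : ContDiff ℝ 1 f) (t : ℝ) :
    HasDerivAt (fun s => radauCoeff a b (fun y => f (y - s)) n)
      (-(radauCoeff a b (fun y => deriv f (y - t)) n)) t := by
  have hfc := hf.continuous
  have hf' : Continuous (deriv f) := hf.continuous_deriv le_rfl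
  rw [radau_formula (u := fun y => deriv f (y - t)) (by fun_prop)]
  have : (fun s => radauCoeff a b (fun y => f (y - s)) n) = fun s => f (b - s) -
      ∑ m ∈ Finset.range n, (2 * (m:ℝ) + 1) / (b - a) *
        ∫ x in a..b, f (x - s) * (Lc a b m).eval x := by
    funext s
    rw [radau_formula (u := fun y => f (y - s)) (by fun_prop)]
  rw [this]
  have h := (hasDerivAt_shift hf b t).sub (HasDerivAt.fun_sum (u := Finset.range n)
    (fun m _ => (hasDerivAt_moment a b hf (Lc a b m).continuous t).const_mul
      ((2 * (m:ℝ) + 1) / (b - a))))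
  refine h.congr_deriv ?_
  simp only [neg_mul, intervalIntegral.integral_neg, mul_neg, Finset.sum_neg_distrib]
  ring

theorem G_formula (k : ℕ) (a b : ℝ) {u0 : ℝ → ℝ} {n : ℕ} (hu : ContDiff ℝ n u0) (i : ℕ)
    (hi : i ≤ n) (t : ℝ) :
    Gfun k a b u0 i t = (-1) ^ i * radauCoeff a b (fun y => iteratedDeriv i u0 (y - t)) (k+1) := by
  induction i generalizing t with
  | zero => simp [Gfun]
  | succ i ih =>
    have ih' : iteratedDeriv i (fun s => radauCoeff a b (fun y => u0 (y - s)) (k + 1))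
      = fun t => (-1) ^ i * radauCoeff a b (fun y => iteratedDeriv i u0 (y - t)) (k+1) := by
      funext s; exact ih (by omega) s
    unfold Gfun
    rw [iteratedDeriv_succ, ih']
    have hc : ContDiff ℝ 1 (iteratedDeriv i u0) := by
      refine ContDiff.iterate_deriv' 1 i ?_ |> fun h => by simpa [iteratedDeriv_eq_iterate] using h
      exact hu.of_le (by exact_mod_cast (by omega : 1 + i ≤ n))
    rw [((hasDerivAt_radau a b (k+1) hc t).const_mul _).deriv, iteratedDeriv_succ]
    ring

theorem G_hasDeriv (k : ℕ) (a b : ℝ) {u0 : ℝ → ℝ} {n : ℕ} (hu : ContDiff ℝ n u0) (i : ℕ)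
    (hi : i + 1 ≤ n) (t : ℝ) :
    HasDerivAt (Gfun k a b u0 i) (Gfun k a b u0 (i+1) t) t := by
  have e : Gfun k a b u0 i = fun t =>
      (-1) ^ i * radauCoeff a b (fun y => iteratedDeriv i u0 (y - t)) (k+1) := by
    funext s; exact G_formula k a b hu i (by omega) s
  have hc : ContDiff ℝ 1 (iteratedDeriv i u0) := by
    refine ContDiff.iterate_deriv' 1 i ?_ |> fun h => by simpa [iteratedDeriv_eq_iterate] using h
    exact hu.of_le (by exact_mod_cast (by omega : 1 + i ≤ n))
  rw [G_formula k a b hu (i+1) hi t, e]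
  refine ((hasDerivAt_radau a b (k+1) hc t).const_mul _).congr_deriv ?_
  rw [iteratedDeriv_succ]; ring

theorem iteratedDeriv_iter_add (i j : ℕ) (f : ℝ → ℝ) :
    iteratedDeriv i (iteratedDeriv j f) = iteratedDeriv (i + j) f := by
  simp only [iteratedDeriv_eq_iterate, Function.iterate_add_apply]

theorem G_bound {k : ℕ} {a b : ℝ} (hab : a < b) {u0 : ℝ → ℝ} (hu : ContDiff ℝ (k+4) u0) {i : ℕ}
    (hi : i ≤ 3) {t M B : ℝ}
    (hB : ∀ m ≤ k, ∀ x ∈ Set.Icc a b, |(Lc a b m).eval x| ≤ B)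
    (hM : ∀ l ≤ k+4, ∀ y ∈ Set.Icc a b, |iteratedDeriv l u0 (y - t)| ≤ M) :
    |Gfun k a b u0 i t| ≤ radC k B * (M * (b - a) ^ (k+1)) := by
  rw [G_formula k a b (n := k+4) (by exact_mod_cast hu) i (by omega) t, abs_mul, abs_pow, abs_neg,
    abs_one, one_pow, one_mul]
  have hc : ContDiff ℝ (k+1) (iteratedDeriv i u0) := by
    have := ContDiff.iterate_deriv' (k+1) i (f := u0)
      (hu.of_le (by exact_mod_cast (by omega : k + 1 + i ≤ k + 4)))
    rw [iteratedDeriv_eq_iterate]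
    exact_mod_cast this
  apply radau_bound hab (u := fun y => iteratedDeriv i u0 (y - t)) (by fun_prop) hB
  intro x hx
  rw [iteratedDeriv_comp_sub_const]
  beta_reduce
  rw [iteratedDeriv_iter_add]
  exact hM _ (by omega) x hx


theorem timepoly (a b : ℝ) {k : ℕ} {p : ℝ → Polynomial ℝ} (hd : ∀ s, (p s).natDegree ≤ k) (t : ℝ)
    (hdiff : ∀ y, DifferentiableAt ℝ (fun s => (p s).eval y) t) :
    ∃ d : Polynomial ℝ, (∀ y, HasDerivAt (fun s => (p s).eval y) (d.eval y) t) ∧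
      (∀ v : Polynomial ℝ, HasDerivAt (fun s => ∫ y in a..b, (p s).eval y * v.eval y)
        (∫ y in a..b, d.eval y * v.eval y) t) ∧
      HasDerivAt (fun s => ∫ y in a..b, (p s).eval y * (p s).eval y)
        (2 * ∫ y in a..b, d.eval y * (p t).eval y) t := by
  set l : ℕ → Polynomial ℝ := fun i =>
    Lagrange.basis (Finset.range (k+1)) (fun n : ℕ => (n:ℝ)) i with hl
  have hp : ∀ s, p s = ∑ i ∈ Finset.range (k+1), Polynomial.C ((p s).eval (i:ℝ)) * l i := by
    intro s
    have := Lagrange.eq_interpolate (s := Finset.range (k+1)) (v := fun n : ℕ => (n:ℝ))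
      (f := p s) (fun i _ j _ h => by simpa using h) (by
        rw [Finset.card_range]
        refine lt_of_le_of_lt Polynomial.degree_le_natDegree ?_
        exact_mod_cast Nat.lt_succ_of_le (hd s))
    rw [Lagrange.interpolate_apply] at this
    exact this
  set D : ℕ → ℝ := fun i => deriv (fun s => (p s).eval (i:ℝ)) t with hD
  set d : Polynomial ℝ := ∑ i ∈ Finset.range (k+1), Polynomial.C (D i) * l i with hdd
  have hDi : ∀ i : ℕ, HasDerivAt (fun s => (p s).eval (i:ℝ)) (D i) t :=
    fun i => (hdiff i).hasDerivAt
  have hpe : ∀ s y, (p s).eval y = ∑ i ∈ Finset.range (k+1),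
      (p s).eval (i:ℝ) * (l i).eval y := by
    intro s y
    conv_lhs => rw [hp s]
    rw [Polynomial.eval_finsetSum]; simp
  have hde : ∀ y, d.eval y = ∑ i ∈ Finset.range (k+1), D i * (l i).eval y := by
    intro y
    rw [hdd, Polynomial.eval_finsetSum]; simp
  have hmom_int : ∀ (c : ℕ → ℝ) (v : Polynomial ℝ),
      ∫ y in a..b, (∑ i ∈ Finset.range (k+1), c i * (l i).eval y) * v.eval y
        = ∑ i ∈ Finset.range (k+1), c i * ∫ y in a..b, (l i).eval y * v.eval y := by
    intro c v
    simp only [Finset.sum_mul, mul_assoc]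
    rw [intervalIntegral.integral_finsetSum
      (fun i _ => (poly_mul_intble _ _ _ _).const_mul _)]
    simp only [intervalIntegral.integral_const_mul]
  have hpv : ∀ s (v : Polynomial ℝ), ∫ y in a..b, (p s).eval y * v.eval y
      = ∑ i ∈ Finset.range (k+1), (p s).eval (i:ℝ) * ∫ y in a..b, (l i).eval y * v.eval y := by
    intro s v
    rw [← hmom_int]
    congr 1; funext y
    conv_lhs => rw [hpe s y]
  have hdv : ∀ (v : Polynomial ℝ), ∫ y in a..b, d.eval y * v.eval y
      = ∑ i ∈ Finset.range (k+1), D i * ∫ y in a..b, (l i).eval y * v.eval y := by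
    intro v
    rw [← hmom_int]
    congr 1; funext y
    rw [hde y]
  have h2 : ∀ v : Polynomial ℝ, HasDerivAt (fun s => ∫ y in a..b, (p s).eval y * v.eval y)
        (∫ y in a..b, d.eval y * v.eval y) t := by
    intro v
    rw [hdv v]
    have : (fun s => ∫ y in a..b, (p s).eval y * v.eval y) = fun s =>
        ∑ i ∈ Finset.range (k+1), (p s).eval (i:ℝ) * ∫ y in a..b, (l i).eval y * v.eval y := by
      funext s; exact hpv s v
    rw [this]
    exact HasDerivAt.fun_sum fun i _ => (hDi i).mul_const _
  refine ⟨d, ?_, h2, ?_⟩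
  · intro y
    rw [hde y]
    have : (fun s => (p s).eval y) = fun s =>
        ∑ i ∈ Finset.range (k+1), (p s).eval (i:ℝ) * (l i).eval y := by
      funext s; exact hpe s y
    rw [this]
    exact HasDerivAt.fun_sum fun i _ => (hDi i).mul_const _
  · have : (fun s => ∫ y in a..b, (p s).eval y * (p s).eval y) = fun s =>
        ∑ i ∈ Finset.range (k+1), (p s).eval (i:ℝ) * ∫ y in a..b, (p s).eval y * (l i).eval y := by
      funext s
      rw [hpv s (p s)]
      simp only [mul_comm (Polynomial.eval _ (l _))]
    rw [this]
    have h := HasDerivAt.fun_sum (u := Finset.range (k+1))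
      fun i _ => (hDi i).mul (h2 (l i))
    refine h.congr_deriv ?_
    rw [Finset.sum_add_distrib, two_mul]
    congr 1
    · rw [hdv (p t)]
      simp only [mul_comm (Polynomial.eval _ (l _))]
    · have e := hpv t d
      have e2 : ∫ y in a..b, d.eval y * (p t).eval y = ∫ y in a..b, (p t).eval y * d.eval y := by
        congr 1; funext y; ring
      rw [e2, e]
      simp only [mul_comm (Polynomial.eval _ (l _))]

/-- The error `u_h - u_I^2` as a polynomial. -/
noncomputable def errPoly (k : ℕ) (a b : ℝ) (u0 : ℝ → ℝ) (P : ℝ → Polynomial ℝ)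
    (F : ℕ → Polynomial ℝ) (uh : ℝ → Polynomial ℝ) (s : ℝ) : Polynomial ℝ :=
  uh s - P s + Polynomial.C ((b - a) / 2 * Gfun k a b u0 1 s) * F 1
    + Polynomial.C (((b - a) / 2) ^ 2 * Gfun k a b u0 2 s) * F 2

theorem errPoly_eval (k : ℕ) (a b : ℝ) (u0 : ℝ → ℝ) (P : ℝ → Polynomial ℝ)
    (F : ℕ → Polynomial ℝ) (uh : ℝ → Polynomial ℝ) (s y : ℝ) :
    (errPoly k a b u0 P F uh s).eval y = (uh s).eval y - uIl k a b u0 P F 2 y s := by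
  unfold errPoly uIl wSum wFun
  rw [Finset.sum_Icc_succ_top (by norm_num)]
  simp
  ring

theorem errPoly_right {k : ℕ} (hk : 2 ≤ k) {a b : ℝ} (hab : a < b) {u0 : ℝ → ℝ}
    {P : ℝ → Polynomial ℝ} {F : ℕ → Polynomial ℝ} (uh : ℝ → Polynomial ℝ) (s : ℝ)
    (hP : IsGRProj k a b (fun y => u0 (y - s)) (P s)) (hF : IsFSeq k a b F) :
    (errPoly k a b u0 P F uh s).eval b = (uh s).eval b - u0 (b - s) := by
  unfold errPoly
  simp [F1_right hab hk hF, F2_right hab hk hF, hP.2.2]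

theorem errPoly_natDegree {k : ℕ} {a b : ℝ} {u0 : ℝ → ℝ}
    {P : ℝ → Polynomial ℝ} {F : ℕ → Polynomial ℝ} {uh : ℝ → Polynomial ℝ} (s : ℝ)
    (hP : IsGRProj k a b (fun y => u0 (y - s)) (P s)) (hF : IsFSeq k a b F)
    (huh : (uh s).natDegree ≤ k) : (errPoly k a b u0 P F uh s).natDegree ≤ k := by
  have h1 : (F 1).natDegree ≤ k := hF.1.1
  have h2 : (F 2).natDegree ≤ k := by simpa using (F2_gr hF).1
  have h3 := hP.1
  unfold errPoly
  refine (Polynomial.natDegree_add_le _ _).trans (max_le ((Polynomial.natDegree_add_le _ _).trans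
    (max_le ((Polynomial.natDegree_sub_le _ _).trans (max_le huh h3)) ?_)) ?_)
  · exact (Polynomial.natDegree_C_mul_le _ _).trans h1
  · exact (Polynomial.natDegree_C_mul_le _ _).trans h2

theorem errPoly_int {k : ℕ} {a b : ℝ} {u0 : ℝ → ℝ}
    {P : ℝ → Polynomial ℝ} {F : ℕ → Polynomial ℝ} {uh : ℝ → Polynomial ℝ} (s : ℝ)
    (v : Polynomial ℝ) :
    ∫ y in a..b, (errPoly k a b u0 P F uh s).eval y * v.eval y
      = (∫ y in a..b, (uh s).eval y * v.eval y) - (∫ y in a..b, (P s).eval y * v.eval y)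
        + (b - a) / 2 * Gfun k a b u0 1 s * (∫ y in a..b, (F 1).eval y * v.eval y)
        + ((b - a) / 2) ^ 2 * Gfun k a b u0 2 s * (∫ y in a..b, (F 2).eval y * v.eval y) := by
  rw [← intervalIntegral.integral_const_mul, ← intervalIntegral.integral_const_mul,
    ← intervalIntegral.integral_sub (poly_mul_intble _ _ _ _) (poly_mul_intble _ _ _ _),
    ← intervalIntegral.integral_add ((poly_mul_intble _ _ _ _).sub (poly_mul_intble _ _ _ _))
      ((poly_mul_intble _ _ _ _).const_mul _),
    ← intervalIntegral.integral_add (((poly_mul_intble _ _ _ _).sub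
      (poly_mul_intble _ _ _ _)).add ((poly_mul_intble _ _ _ _).const_mul _))
      ((poly_mul_intble _ _ _ _).const_mul _)]
  congr 1; funext y
  simp [errPoly]; ring

theorem local_energy {k : ℕ} (hk : 2 ≤ k) {a b : ℝ} (hab : a < b) {u0 : ℝ → ℝ}
    (hu : ContDiff ℝ (k+4) u0) {P : ℝ → Polynomial ℝ} {F : ℕ → Polynomial ℝ}
    {uh : ℝ → Polynomial ℝ}
    (hP : ∀ s, IsGRProj k a b (fun y => u0 (y - s)) (P s)) (hF : IsFSeq k a b F)
    (huh : ∀ s, (uh s).natDegree ≤ k) (huc : ∀ y, ContDiff ℝ 1 (fun s => (uh s).eval y))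
    (t um : ℝ)
    (hDG : ∀ v : Polynomial ℝ, v.natDegree ≤ k →
      (∫ y in a..b, deriv (fun s => (uh s).eval y) t * v.eval y)
      - (∫ y in a..b, (uh t).eval y * v.derivative.eval y)
      + (uh t).eval b * v.eval b - um * v.eval a = 0) :
    ∃ E' : ℝ, HasDerivAt (fun s => ∫ y in a..b, (errPoly k a b u0 P F uh s).eval y
        * (errPoly k a b u0 P F uh s).eval y) E' t ∧
      E' ≤ (um - u0 (a - t)) ^ 2 - ((errPoly k a b u0 P F uh t).eval b) ^ 2
        + 2 * ∫ y in a..b, (Polynomial.C (((b - a) / 2) ^ 2 * Gfun k a b u0 3 t) * F 2).eval y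
          * (errPoly k a b u0 P F uh t).eval y := by
  have hba : b - a ≠ 0 := by linarith
  have hu1 : ContDiff ℝ 1 u0 := hu.of_le (by exact_mod_cast (by omega : 1 ≤ k + 4))
  have huN : ContDiff ℝ ((k + 4 : ℕ)) u0 := by exact_mod_cast hu
  have hu' : Continuous (deriv u0) := hu1.continuous_deriv le_rfl
  have hu0c := hu1.continuous
  have hG0 := G_hasDeriv k a b huN 0 (by omega) t
  have hG1 := G_hasDeriv k a b huN 1 (by omega) t
  have hG2 := G_hasDeriv k a b huN 2 (by omega) t
  simp only [zero_add, Nat.reduceAdd] at hG0 hG1 hG2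
  have hG0e : ∀ s, Gfun k a b u0 0 s = radauCoeff a b (fun y => u0 (y - s)) (k+1) := by
    intro s; simp [Gfun]
  obtain ⟨du, hdu, hduv, -⟩ := timepoly a b huh t
    (fun y => ((huc y).differentiable (by norm_num)) t)
  have hPdiff : ∀ y, DifferentiableAt ℝ (fun s => (P s).eval y) t := by
    intro y
    have : (fun s => (P s).eval y) = fun s => (∑ m ∈ Finset.range k,
      (2 * (m:ℝ) + 1) / (b - a) * (∫ x in a..b, u0 (x - s) * (Lc a b m).eval x)
        * ((Lc a b m).eval y - (Lc a b k).eval y)) + u0 (b - s) * (Lc a b k).eval y := by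
      funext s; exact gr_formula hab (hP s) y
    rw [this]
    refine ((HasDerivAt.fun_sum fun m _ => (((hasDerivAt_moment a b hu1
      (Lc a b m).continuous t).const_mul _).mul_const _)).add
        ((hasDerivAt_shift hu1 b t).mul_const _)).differentiableAt
  obtain ⟨d, hd, hdv, hdd⟩ := timepoly a b (p := errPoly k a b u0 P F uh)
    (fun s => errPoly_natDegree s (hP s) hF (huh s)) t (by
      intro y
      have h1 := (hdu y).differentiableAt
      have h2 := hPdiff y
      have h3 := hG1.differentiableAt
      have h4 := hG2.differentiableAt
      have : (fun s => (errPoly k a b u0 P F uh s).eval y) = fun s =>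
          (uh s).eval y - (P s).eval y + ((b - a) / 2 * Gfun k a b u0 1 s) * (F 1).eval y
            + (((b - a) / 2) ^ 2 * Gfun k a b u0 2 s) * (F 2).eval y := by
        funext s; simp [errPoly]
      rw [this]
      exact ((h1.sub h2).add ((h3.const_mul _).mul_const _)).add ((h4.const_mul _).mul_const _))
  refine ⟨_, hdd, ?_⟩
  set e := errPoly k a b u0 P F uh t with he
  have hen : e.natDegree ≤ k := errPoly_natDegree t (hP t) hF (huh t)
  -- derivative of the moment against `e`
  have hmom := hdv e
  have hmom2 : HasDerivAt (fun s => ∫ y in a..b, (errPoly k a b u0 P F uh s).eval y * e.eval y)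
      ((∫ y in a..b, du.eval y * e.eval y)
        - ((∫ y in a..b, -(deriv u0 (y - t)) * e.eval y)
          + Gfun k a b u0 1 t * ∫ y in a..b, (Lc a b k).eval y * e.eval y)
        + (b - a) / 2 * Gfun k a b u0 2 t * (∫ y in a..b, (F 1).eval y * e.eval y)
        + ((b - a) / 2) ^ 2 * Gfun k a b u0 3 t * (∫ y in a..b, (F 2).eval y * e.eval y)) t := by
    have : (fun s => ∫ y in a..b, (errPoly k a b u0 P F uh s).eval y * e.eval y) = fun s =>
        (∫ y in a..b, (uh s).eval y * e.eval y) - ((∫ y in a..b, u0 (y - s) * e.eval y)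
          + Gfun k a b u0 0 s * ∫ y in a..b, (Lc a b k).eval y * e.eval y)
        + (b - a) / 2 * Gfun k a b u0 1 s * (∫ y in a..b, (F 1).eval y * e.eval y)
        + ((b - a) / 2) ^ 2 * Gfun k a b u0 2 s * (∫ y in a..b, (F 2).eval y * e.eval y) := by
      funext s
      rw [errPoly_int, hG0e s, gr_moment hab (u := fun y => u0 (y - s)) (by fun_prop) (hP s) e hen]
    rw [this]
    exact (((hduv e).sub ((hasDerivAt_moment a b hu1 e.continuous t).add
      (hG0.mul_const _))).add ((hG1.const_mul _).mul_const _)).add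
        ((hG2.const_mul _).mul_const _)
  have hkey := hmom.unique hmom2
  -- DG equation
  have hdg := hDG e hen
  have hdue : ∀ y, deriv (fun s => (uh s).eval y) t = du.eval y := fun y => (hdu y).deriv
  simp only [hdue] at hdg
  -- integration by parts for `u`
  have hibp : ∫ y in a..b, -(deriv u0 (y - t)) * e.eval y
      = -(u0 (b - t) * e.eval b - u0 (a - t) * e.eval a)
        + ∫ y in a..b, u0 (y - t) * e.derivative.eval y := by
    have := integral_deriv_mul_eq_sub (a := a) (b := b)
      (u := fun y => u0 (y - t)) (v := fun y => e.eval y)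
      (u' := fun y => deriv u0 (y - t)) (v' := fun y => e.derivative.eval y)
      (fun y _ => by
        have h1 : HasDerivAt u0 (deriv u0 (y - t)) (y - t) :=
          (hu1.differentiable (by norm_num) _).hasDerivAt
        simpa [Function.comp_def] using h1.comp_sub_const y t)
      (fun y _ => e.hasDerivAt y)
      (by apply Continuous.intervalIntegrable; fun_prop) (poly_intble _ a b)
    have hec := e.continuous
    have hec' := e.derivative.continuous
    rw [intervalIntegral.integral_add
      (by apply Continuous.intervalIntegrable; fun_prop)
      (by apply Continuous.intervalIntegrable; fun_prop)] at this
    simp only [neg_mul, intervalIntegral.integral_neg]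
    linarith
  -- expand `∫ e e'`
  have hee := errPoly_int (k := k) (a := a) (b := b) (u0 := u0) (P := P) (F := F) (uh := uh) t
    e.derivative
  rw [(hP t).2.1 _ (natDegree_deriv_ok (by omega) hen), F1_ibp hab hk hF e hen,
    F2_ibp hab hk hF e hen, ← he] at hee
  have hsq := poly_ibp e e a b
  have hcomm : ∫ x in a..b, e.derivative.eval x * e.eval x
      = ∫ x in a..b, e.eval x * e.derivative.eval x := by
    congr 1; funext y; ring
  rw [hcomm] at hsq
  have heb := errPoly_right hk hab uh t (hP t) hF
  rw [← he] at heb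
  have hR : ∫ y in a..b, (Polynomial.C (((b - a) / 2) ^ 2 * Gfun k a b u0 3 t) * F 2).eval y
          * e.eval y = ((b - a) / 2) ^ 2 * Gfun k a b u0 3 t *
            ∫ y in a..b, (F 2).eval y * e.eval y := by
    rw [← intervalIntegral.integral_const_mul]
    congr 1; funext y; simp; ring
  rw [hR, hkey, hibp]
  have e1 : (b - a) / 2 * Gfun k a b u0 1 t * (-(2 / (b - a)) *
      ∫ x in a..b, (Lc a b k).eval x * e.eval x)
      = - (Gfun k a b u0 1 t * ∫ x in a..b, (Lc a b k).eval x * e.eval x) := by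
    field_simp
  have e2 : ((b - a) / 2) ^ 2 * Gfun k a b u0 2 t * ((2 / (b - a)) *
      ∫ x in a..b, (F 1).eval x * e.eval x)
      = (b - a) / 2 * Gfun k a b u0 2 t * ∫ x in a..b, (F 1).eval x * e.eval x := by
    field_simp
  rw [e1, e2] at hee
  generalize (∫ x in a..b, e.eval x * e.derivative.eval x) = I1 at *
  generalize (∫ x in a..b, du.eval x * e.eval x) = I2 at *
  generalize (∫ x in a..b, u0 (x - t) * e.derivative.eval x) = I3 at *
  generalize (∫ x in a..b, (uh t).eval x * e.derivative.eval x) = I4 at *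
  generalize Gfun k a b u0 1 t * (∫ x in a..b, (Lc a b k).eval x * e.eval x) = I5 at *
  generalize (b - a) / 2 * Gfun k a b u0 2 t * (∫ x in a..b, (F 1).eval x * e.eval x) = I6 at *
  have heb' : (uh t).eval b = e.eval b + u0 (b - t) := by linarith
  rw [heb'] at hdg
  nlinarith [sq_nonneg (um - u0 (a - t) - e.eval a)]


theorem sum_tele (g : ℕ → ℝ) (N : ℕ) :
    ∑ j ∈ Finset.Icc 1 N, (g j - g (j - 1)) = g N - g 0 := by
  induction N with
  | zero => simp
  | succ n ih =>
    rw [Finset.sum_Icc_succ_top (by omega), ih]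
    simp

theorem cs_poly (s : Finset ℕ) (a b : ℕ → ℝ) (hab : ∀ j ∈ s, a j ≤ b j)
    (f g : ℕ → Polynomial ℝ) :
    (∑ j ∈ s, ∫ y in (a j)..(b j), (f j).eval y * (g j).eval y) ^ 2
      ≤ (∑ j ∈ s, ∫ y in (a j)..(b j), (f j).eval y * (f j).eval y)
        * (∑ j ∈ s, ∫ y in (a j)..(b j), (g j).eval y * (g j).eval y) := by
  set p := ∑ j ∈ s, ∫ y in (a j)..(b j), (f j).eval y * (f j).eval y with hp
  set q := ∑ j ∈ s, ∫ y in (a j)..(b j), (f j).eval y * (g j).eval y with hq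
  set r := ∑ j ∈ s, ∫ y in (a j)..(b j), (g j).eval y * (g j).eval y with hr
  have h : ∀ z : ℝ, 0 ≤ r * (z * z) + 2 * q * z + p := by
    intro z
    have e : r * (z * z) + 2 * q * z + p = ∑ j ∈ s, ∫ y in (a j)..(b j),
        ((f j).eval y + z * (g j).eval y) ^ 2 := by
      rw [hp, hq, hr, Finset.sum_mul, Finset.mul_sum, Finset.sum_mul, ← Finset.sum_add_distrib,
        ← Finset.sum_add_distrib]
      apply Finset.sum_congr rfl
      intro j _
      rw [← intervalIntegral.integral_mul_const, ← intervalIntegral.integral_const_mul,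
        ← intervalIntegral.integral_mul_const,
        ← intervalIntegral.integral_add ((poly_mul_intble _ _ _ _).mul_const _)
          (((poly_mul_intble _ _ _ _).const_mul _).mul_const _),
        ← intervalIntegral.integral_add (((poly_mul_intble _ _ _ _).mul_const _).add
          (((poly_mul_intble _ _ _ _).const_mul _).mul_const _)) (poly_mul_intble _ _ _ _)]
      congr 1; funext y; ring
    rw [e]
    exact Finset.sum_nonneg fun j hj =>
      intervalIntegral.integral_nonneg (hab j hj) fun y _ => sq_nonneg _
  have := discrim_le_zero h
  unfold discrim at this
  nlinarith

theorem inverse_ineq {a b : ℝ} (hab : a < b) {k : ℕ} {B : ℝ} (hB1 : 1 ≤ B)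
    (hB : ∀ m ≤ k, ∀ x ∈ Set.Icc a b, |(Lc a b m).eval x| ≤ B)
    (q : Polynomial ℝ) (hq : q.natDegree ≤ k) {y : ℝ} (hy : y ∈ Set.Icc a b) :
    (q.eval y) ^ 2 ≤ (radC k B) ^ 2 / (b - a) * ∫ x in a..b, q.eval x * q.eval x := by
  have hba : 0 < b - a := by linarith
  set I := ∫ x in a..b, q.eval x * q.eval x with hI
  have hI0 : 0 ≤ I := intervalIntegral.integral_nonneg hab.le fun x _ => mul_self_nonneg _
  have hmom : ∀ m : ℕ, |∫ x in a..b, q.eval x * (Lc a b m).eval x| ≤ Real.sqrt ((b - a) * I) := by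
    intro m
    apply Real.abs_le_sqrt
    have := cs_poly {0} (fun _ => a) (fun _ => b) (fun _ _ => hab.le) (fun _ => q)
      (fun _ => Lc a b m)
    simp only [Finset.sum_singleton] at this
    rw [Lc_norm hab] at this
    refine this.trans ?_
    rw [mul_comm]
    gcongr
    exact div_le_self hba.le (by linarith [(Nat.cast_nonneg m : (0:ℝ) ≤ m)])
  have hexp := Lc_expand hab k q hq y
  have hle : |q.eval y| ≤ radC k B / (b - a) * Real.sqrt ((b - a) * I) := by
    have h1 : |q.eval y| ≤ ∑ m ∈ Finset.range (k+1),
        (2 * (m:ℝ) + 1) * B / (b - a) * Real.sqrt ((b - a) * I) := by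
      rw [hexp]
      refine (Finset.abs_sum_le_sum_abs _ _).trans (Finset.sum_le_sum ?_)
      intro m hm
      rw [Finset.mem_range] at hm
      rw [abs_mul, abs_mul, abs_of_nonneg (by positivity : 0 ≤ (2 * (m:ℝ) + 1) / (b - a))]
      calc _ ≤ (2 * (m:ℝ) + 1) / (b - a) * Real.sqrt ((b - a) * I) * B := by
            gcongr
            · exact hmom m
            · exact hB m (by omega) y hy
        _ = _ := by ring
    refine h1.trans ?_
    rw [← Finset.sum_mul, ← Finset.sum_div]
    unfold radC
    gcongr
    linarith
  have h2 := pow_le_pow_left₀ (abs_nonneg _) hle 2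
  rw [sq_abs, mul_pow, Real.sq_sqrt (by positivity)] at h2
  refine h2.trans (le_of_eq ?_)
  field_simp

theorem gronwall_sqrt {T K : ℝ} (hK : 0 ≤ K) {E : ℝ → ℝ} (hE0 : ∀ s, 0 ≤ E s)
    (hE : ∀ s ∈ Set.Icc (0:ℝ) T, ∃ E' : ℝ, HasDerivAt E E' s ∧ E' ≤ 2 * K * Real.sqrt (E s))
    {t : ℝ} (ht : t ∈ Set.Icc (0:ℝ) T) :
    Real.sqrt (E t) ≤ Real.sqrt (E 0) + K * t := by
  apply le_of_forall_pos_le_add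
  intro δ hδ
  have hpos : ∀ s, 0 < E s + δ ^ 2 := fun s => by have := hE0 s; positivity
  have hanti : AntitoneOn (fun s => Real.sqrt (E s + δ ^ 2) - K * s) (Set.Icc 0 T) := by
    have hder : ∀ s ∈ Set.Icc (0:ℝ) T, ∃ D, HasDerivAt
        (fun s => Real.sqrt (E s + δ ^ 2) - K * s) D s ∧ D ≤ 0 := by
      intro s hs
      obtain ⟨E', h1, h2⟩ := hE s hs
      refine ⟨_, ((h1.add_const (δ ^ 2)).sqrt (hpos s).ne').sub ((hasDerivAt_id s).const_mul K), ?_⟩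
      have h3 : 0 < Real.sqrt (E s + δ ^ 2) := Real.sqrt_pos.2 (hpos s)
      have h4 : Real.sqrt (E s) ≤ Real.sqrt (E s + δ ^ 2) :=
        Real.sqrt_le_sqrt (by nlinarith)
      rw [mul_one, sub_nonpos, div_le_iff₀ (by positivity)]
      nlinarith
    apply antitoneOn_of_deriv_nonpos (convex_Icc 0 T)
    · intro s hs
      obtain ⟨D, h, _⟩ := hder s hs
      exact h.continuousAt.continuousWithinAt
    · intro s hs
      rw [interior_Icc] at hs
      obtain ⟨D, h, _⟩ := hder s (Set.Ioo_subset_Icc_self hs)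
      exact h.differentiableAt.differentiableWithinAt
    · intro s hs
      rw [interior_Icc] at hs
      obtain ⟨D, h, hD⟩ := hder s (Set.Ioo_subset_Icc_self hs)
      rw [h.deriv]; exact hD
  have h1 := hanti (Set.left_mem_Icc.2 (ht.1.trans ht.2)) ht ht.1
  simp only [mul_zero, sub_zero] at h1
  have h2 : Real.sqrt (E t) ≤ Real.sqrt (E t + δ ^ 2) := Real.sqrt_le_sqrt (by nlinarith)
  have h3 : Real.sqrt (E 0 + δ ^ 2) ≤ Real.sqrt (E 0) + δ := by
    rw [Real.sqrt_le_left (by positivity)]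
    nlinarith [Real.sq_sqrt (hE0 0), Real.sqrt_nonneg (E 0)]
  linarith

theorem mesh_mono {N : ℕ} {x : ℕ → ℝ} (hx : ∀ j < N, x j < x (j+1)) {i j : ℕ} (hij : i ≤ j)
    (hj : j ≤ N) : x i ≤ x j := by
  induction j, hij using Nat.le_induction with
  | base => exact le_rfl
  | succ n _ ih => exact (ih (by omega)).trans (hx n (by omega)).le


theorem global_energy {k N : ℕ} (hk : 2 ≤ k) {x : ℕ → ℝ} {T : ℝ} (hN : 1 ≤ N)
    (hx0 : x 0 = 0) (hxN : x N = 2 * Real.pi) (hx : ∀ j ∈ Finset.Icc 1 N, x (j-1) < x j)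
    {u0 : ℝ → ℝ} (hu : ContDiff ℝ (k+4) u0)
    {P : ℕ → ℝ → Polynomial ℝ}
    (hP : ∀ j ∈ Finset.Icc 1 N, ∀ t : ℝ,
      IsGRProj k (x (j-1)) (x j) (fun y => u0 (y - t)) (P j t))
    {F : ℕ → ℕ → Polynomial ℝ}
    (hF : ∀ j ∈ Finset.Icc 1 N, IsFSeq k (x (j-1)) (x j) (F j))
    {inflow : ℝ → ℝ} {uh : ℕ → ℝ → Polynomial ℝ}
    (hDG : IsDGSol k N x T inflow uh)
    (hbc : ((∀ t, inflow t = (uh N t).eval (x N))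
              ∧ (∀ y : ℝ, u0 (y + 2 * Real.pi) = u0 y))
            ∨ (∀ t, inflow t = u0 (-t)))
    {K : ℝ} (hK0 : 0 ≤ K)
    (hK : ∀ j ∈ Finset.Icc 1 N, ∀ t ∈ Set.Icc (0:ℝ) T, ∀ y ∈ Set.Icc (x (j-1)) (x j),
      |(Polynomial.C (((x j - x (j-1)) / 2) ^ 2 * Gfun k (x (j-1)) (x j) u0 3 t)
        * F j 2).eval y| ≤ K)
    {t : ℝ} (ht : t ∈ Set.Icc (0:ℝ) T) :
    Real.sqrt (∑ j ∈ Finset.Icc 1 N, ∫ y in (x (j-1))..(x j),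
        (errPoly k (x (j-1)) (x j) u0 (P j) (F j) (uh j) t).eval y
          * (errPoly k (x (j-1)) (x j) u0 (P j) (F j) (uh j) t).eval y)
      ≤ Real.sqrt (∑ j ∈ Finset.Icc 1 N, ∫ y in (x (j-1))..(x j),
        (errPoly k (x (j-1)) (x j) u0 (P j) (F j) (uh j) 0).eval y
          * (errPoly k (x (j-1)) (x j) u0 (P j) (F j) (uh j) 0).eval y) + 3 * K * t := by
  set e : ℕ → ℝ → Polynomial ℝ := fun j s =>
    errPoly k (x (j-1)) (x j) u0 (P j) (F j) (uh j) s with he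
  refine gronwall_sqrt (E := fun s => ∑ j ∈ Finset.Icc 1 N, ∫ y in (x (j-1))..(x j),
    (e j s).eval y * (e j s).eval y) (by positivity) ?_ ?_ ht
  · intro s
    exact Finset.sum_nonneg fun j hj =>
      intervalIntegral.integral_nonneg (hx j hj).le fun y _ => mul_self_nonneg _
  intro s hs
  obtain ⟨hd, hc, heq⟩ := hDG
  set f : ℕ → Polynomial ℝ := fun j =>
    Polynomial.C (((x j - x (j-1)) / 2) ^ 2 * Gfun k (x (j-1)) (x j) u0 3 s) * F j 2 with hf
  set um : ℕ → ℝ := fun j => if j = 1 then inflow s else (uh (j-1) s).eval (x (j-1)) with hum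
  have hloc : ∀ j : ℕ, ∃ E' : ℝ, j ∈ Finset.Icc 1 N →
      HasDerivAt (fun s => ∫ y in (x (j-1))..(x j), (e j s).eval y * (e j s).eval y) E' s ∧
      E' ≤ (um j - u0 (x (j-1) - s)) ^ 2 - ((e j s).eval (x j)) ^ 2
        + 2 * ∫ y in (x (j-1))..(x j), (f j).eval y * (e j s).eval y := by
    intro j
    by_cases hj : j ∈ Finset.Icc 1 N
    · obtain ⟨E', h⟩ := local_energy hk (hx j hj) hu (hP j hj) (hF j hj) (hd j hj) (hc j hj) s (um j)
        (fun v hv => heq j hj s hs v hv)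
      exact ⟨E', fun _ => h⟩
    · exact ⟨0, fun h => absurd h hj⟩
  choose E' hE' using hloc
  refine ⟨∑ j ∈ Finset.Icc 1 N, E' j, HasDerivAt.fun_sum fun j hj => (hE' j hj).1, ?_⟩
  -- boundary terms
  have hright : ∀ j ∈ Finset.Icc 1 N, (e j s).eval (x j) = (uh j s).eval (x j) - u0 (x j - s) :=
    fun j hj => errPoly_right hk (hx j hj) (uh j) s (hP j hj s) (hF j hj)
  have hbdry : ∑ j ∈ Finset.Icc 1 N,
      ((um j - u0 (x (j-1) - s)) ^ 2 - ((e j s).eval (x j)) ^ 2) ≤ 0 := by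
    set g : ℕ → ℝ := fun j => if j = 0 then (inflow s - u0 (x 0 - s)) ^ 2
      else ((e j s).eval (x j)) ^ 2 with hg
    have h1 : ∀ j ∈ Finset.Icc 1 N, ((um j - u0 (x (j-1) - s)) ^ 2 - ((e j s).eval (x j)) ^ 2)
        = -(g j - g (j-1)) := by
      intro j hj
      have hj' := Finset.mem_Icc.1 hj
      have hj0 : j ≠ 0 := by omega
      by_cases hj1 : j = 1
      · subst hj1
        simp [hg, hum]
      · have hj2 : j - 1 ≠ 0 := by omega
        have := hright (j-1) (Finset.mem_Icc.2 ⟨by omega, by omega⟩)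
        simp only [hg, hum, if_neg hj0, if_neg hj1, if_neg hj2, this]
        ring
    rw [Finset.sum_congr rfl h1, Finset.sum_neg_distrib, sum_tele]
    have hN0 : N ≠ 0 := by omega
    have hgN : g N = ((uh N s).eval (x N) - u0 (x N - s)) ^ 2 := by
      simp only [hg, if_neg hN0]
      rw [hright N (Finset.mem_Icc.2 ⟨hN, le_rfl⟩)]
    have hg0 : g 0 = (inflow s - u0 (0 - s)) ^ 2 := by simp [hg, hx0]
    rcases hbc with ⟨h1, h2⟩ | h1
    · have h3 := h2 (0 - s)
      rw [hgN, hg0, h1, hxN, ← h3]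
      have : 0 - s + 2 * Real.pi = 2 * Real.pi - s := by ring
      rw [this]; linarith
    · rw [hg0, h1, zero_sub, sub_self, hgN]
      nlinarith [sq_nonneg ((uh N s).eval (x N) - u0 (x N - s))]
  -- residual
  have hcs := cs_poly (Finset.Icc 1 N) (fun j => x (j-1)) x (fun j hj => (hx j hj).le) f
    (fun j => e j s)
  have hff : ∑ j ∈ Finset.Icc 1 N, ∫ y in (x (j-1))..(x j), (f j).eval y * (f j).eval y
      ≤ (3 * K) ^ 2 := by
    calc _ ≤ ∑ j ∈ Finset.Icc 1 N, (x j - x (j-1)) * K ^ 2 := by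
          refine Finset.sum_le_sum fun j hj => ?_
          have : (x j - x (j-1)) * K ^ 2 = ∫ y in (x (j-1))..(x j), K ^ 2 := by simp
          rw [this]
          refine intervalIntegral.integral_mono_on (hx j hj).le (poly_mul_intble _ _ _ _)
            intervalIntegrable_const ?_
          intro y hy
          rw [← sq]
          exact sq_le_sq' (neg_le_of_abs_le (hK j hj s hs y hy)) (le_of_abs_le (hK j hj s hs y hy))
      _ = 2 * Real.pi * K ^ 2 := by
          rw [← Finset.sum_mul, sum_tele, hxN, hx0, sub_zero]
      _ ≤ _ := by nlinarith [Real.pi_lt_four, sq_nonneg K]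
  set S := ∑ j ∈ Finset.Icc 1 N, ∫ y in (x (j-1))..(x j), (e j s).eval y * (e j s).eval y with hS
  have hS0 : 0 ≤ S := Finset.sum_nonneg fun j hj =>
      intervalIntegral.integral_nonneg (hx j hj).le fun y _ => mul_self_nonneg _
  have hres : ∑ j ∈ Finset.Icc 1 N, ∫ y in (x (j-1))..(x j), (f j).eval y * (e j s).eval y
      ≤ 3 * K * Real.sqrt S := by
    apply le_of_abs_le
    apply abs_le_of_sq_le_sq _ (by positivity)
    rw [mul_pow, Real.sq_sqrt hS0]
    exact hcs.trans (mul_le_mul_of_nonneg_right hff hS0)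
  calc ∑ j ∈ Finset.Icc 1 N, E' j ≤ ∑ j ∈ Finset.Icc 1 N,
        (((um j - u0 (x (j-1) - s)) ^ 2 - ((e j s).eval (x j)) ^ 2)
        + 2 * ∫ y in (x (j-1))..(x j), (f j).eval y * (e j s).eval y) :=
        Finset.sum_le_sum fun j hj => (hE' j hj).2
    _ ≤ 2 * (3 * K) * Real.sqrt S := by
        rw [Finset.sum_add_distrib, ← Finset.mul_sum]
        linarith

set_option maxHeartbeats 4000000 in
/-- superconvergence of the DG solution at the interior right Radau points,
`|u(r,t) - u_h(r,t)| ≤ C (1+t) h^{k+2} M_{k+4}`, given the initial error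
`‖u_h(·,0) - u_I^2(·,0)‖₀ ≤ C₀ h^{k+3} M_{k+4}`. -/
theorem stmt19 (k : ℕ) (hk : 2 ≤ k) (c : ℝ) (hc : 1 ≤ c) (C₀ : ℝ) :
    ∃ C : ℝ, 0 < C ∧
      ∀ (N : ℕ) (x : ℕ → ℝ) (h T : ℝ), 1 ≤ N → x 0 = 0 → x N = 2 * Real.pi →
        (∀ j < N, x j < x (j+1)) →
        (∀ j ∈ Finset.Icc 1 N, x j - x (j-1) ≤ h) →
        (∀ j ∈ Finset.Icc 1 N, h ≤ c * (x j - x (j-1))) →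
        0 < T →
        ∀ u0 : ℝ → ℝ, ContDiff ℝ (k+4) u0 →
        ∀ M : ℝ,
          (∀ i ≤ k+4, ∀ y ∈ Set.Icc (-T) (2 * Real.pi), |iteratedDeriv i u0 y| ≤ M) →
        ∀ P : ℕ → ℝ → Polynomial ℝ,
          (∀ j ∈ Finset.Icc 1 N, ∀ t : ℝ,
            IsGRProj k (x (j-1)) (x j) (fun y => u0 (y - t)) (P j t)) →
        ∀ F : ℕ → ℕ → Polynomial ℝ,
          (∀ j ∈ Finset.Icc 1 N, IsFSeq k (x (j-1)) (x j) (F j)) →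
        ∀ (inflow : ℝ → ℝ) (uh : ℕ → ℝ → Polynomial ℝ),
          IsDGSol k N x T inflow uh →
          (((∀ t, inflow t = (uh N t).eval (x N))
              ∧ (∀ y : ℝ, u0 (y + 2 * Real.pi) = u0 y))
            ∨ (∀ t, inflow t = u0 (-t))) →
          Real.sqrt (∑ j ∈ Finset.Icc 1 N, ∫ y in (x (j-1))..(x j),
              ((uh j 0).eval y - uIl k (x (j-1)) (x j) u0 (P j) (F j) 2 y 0)^2)
            ≤ C₀ * h^(k+3) * M →
        ∀ j ∈ Finset.Icc 1 N, ∀ t ∈ Set.Icc (0:ℝ) T,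
        ∀ r ∈ Set.Ioo (x (j-1)) (x j),
          legendreCell (k+1) (x (j-1)) (x j) r - legendreCell k (x (j-1)) (x j) r = 0 →
          |u0 (r - t) - (uh j t).eval r| ≤ C * (1 + t) * h^(k+2) * M := by

  obtain ⟨B, hB1, hBall⟩ := leg_bound_all k
  set R := radC k B with hR
  set St := stabC k B with hSt
  have hR0 : 0 ≤ R := radC_nonneg k hB1
  have hSt0 : 0 ≤ St := stabC_nonneg k hB1
  set f1 := St * (2 * B) with hf1
  set f2 := St * (2 * (St * (2 * B))) with hf2
  have hB0 : 0 ≤ B := by linarith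
  have hf10 : 0 ≤ f1 := by positivity
  have hf20 : 0 ≤ f2 := by positivity
  have hc0 : 0 < c := by linarith
  set A := |C₀| + 3 * (R * f2) with hA
  have hA0 : 0 ≤ A := by positivity
  refine ⟨3 * R * c * A + (1 + St) + R * f1 + 9 * c * R * f2 + 1, by positivity, ?_⟩
  intro N x h T hN hx0 hxN hmesh hhj hqu hT u0 hu M hM P hP F hF inflow uh hDG hbc hinit
    j hj t ht r hr hroot
  have hlt : ∀ j ∈ Finset.Icc 1 N, x (j-1) < x j := by
    intro j hj
    rw [Finset.mem_Icc] at hj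
    have := hmesh (j-1) (by omega)
    rwa [Nat.sub_add_cancel hj.1] at this
  have hlo : ∀ j ∈ Finset.Icc 1 N, 0 ≤ x (j-1) := by
    intro j hj
    rw [Finset.mem_Icc] at hj
    rw [← hx0]; exact mesh_mono hmesh (by omega) (by omega)
  have hhi : ∀ j ∈ Finset.Icc 1 N, x j ≤ 2 * Real.pi := by
    intro j hj
    rw [Finset.mem_Icc] at hj
    rw [← hxN]; exact mesh_mono hmesh (by omega) le_rfl
  have hcellM : ∀ j ∈ Finset.Icc 1 N, ∀ s ∈ Set.Icc (0:ℝ) T, ∀ l ≤ k+4,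
      ∀ y ∈ Set.Icc (x (j-1)) (x j), |iteratedDeriv l u0 (y - s)| ≤ M := by
    intro j hj s hs l hl y hy
    apply hM l hl
    have := hlo j hj
    have := hhi j hj
    constructor
    · linarith [hy.1, hs.2]
    · linarith [hy.2, hs.1]
  have hM0 : 0 ≤ M := (abs_nonneg _).trans
    (hM 0 (by omega) 0 ⟨by linarith, by positivity⟩)
  have hh0 : 0 < h := lt_of_lt_of_le (by linarith [hlt j hj]) (hhj j hj)
  have hh9 : h ≤ 9 * c := by
    have := hqu j hj
    have h1 : x j - x (j-1) ≤ 9 := by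
      linarith [hlo j hj, hhi j hj, Real.pi_lt_four]
    nlinarith
  have hGb : ∀ j ∈ Finset.Icc 1 N, ∀ s ∈ Set.Icc (0:ℝ) T, ∀ i ≤ 3,
      |Gfun k (x (j-1)) (x j) u0 i s| ≤ R * (M * h ^ (k+1)) := by
    intro j hj s hs i hi
    refine (G_bound (hlt j hj) hu hi (fun m hm => hBall m hm _ _ (hlt j hj))
      (hcellM j hj s hs)).trans ?_
    have : 0 ≤ x j - x (j-1) := by linarith [hlt j hj]
    gcongr
    exact hhj j hj
  have hw : ∀ j ∈ Finset.Icc 1 N, (x j - x (j-1)) / 2 ≤ h ∧ 0 ≤ (x j - x (j-1)) / 2 := by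
    intro j hj
    have := hhj j hj
    have := hlt j hj
    constructor <;> linarith
  have hF1 : ∀ j ∈ Finset.Icc 1 N, ∀ y ∈ Set.Icc (x (j-1)) (x j), |(F j 1).eval y| ≤ f1 :=
    fun j hj y hy => F1_bound (hlt j hj) (hF j hj) hB1
      (fun m hm => hBall m hm _ _ (hlt j hj)) hy
  have hF2 : ∀ j ∈ Finset.Icc 1 N, ∀ y ∈ Set.Icc (x (j-1)) (x j), |(F j 2).eval y| ≤ f2 :=
    fun j hj y hy => F2_bound (hlt j hj) (hF j hj) hB1
      (fun m hm => hBall m hm _ _ (hlt j hj)) hy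
  have hw2 : ∀ j ∈ Finset.Icc 1 N, ∀ s ∈ Set.Icc (0:ℝ) T, ∀ i ≤ 3,
      ∀ y ∈ Set.Icc (x (j-1)) (x j),
      |((x j - x (j-1)) / 2) ^ 2 * Gfun k (x (j-1)) (x j) u0 i s * (F j 2).eval y|
        ≤ R * f2 * h ^ (k+3) * M := by
    intro j hj s hs i hi y hy
    rw [abs_mul, abs_mul, abs_pow, abs_of_nonneg (hw j hj).2]
    calc _ ≤ h ^ 2 * (R * (M * h ^ (k+1))) * f2 := by
          have h1 := hGb j hj s hs i hi
          have h2 := hF2 j hj y hy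
          have h3 := (hw j hj).1
          have h4 := (hw j hj).2
          gcongr
      _ = _ := by ring
  have hw1 : |(x j - x (j-1)) / 2 * Gfun k (x (j-1)) (x j) u0 1 t * (F j 1).eval r|
        ≤ R * f1 * h ^ (k+2) * M := by
    rw [abs_mul, abs_mul, abs_of_nonneg (hw j hj).2]
    calc _ ≤ h * (R * (M * h ^ (k+1))) * f1 := by
          have h1 := hGb j hj t ht 1 (by norm_num)
          have h2 := hF1 j hj r (Set.Ioo_subset_Icc_self hr)
          have h3 := (hw j hj).1
          have h4 := (hw j hj).2
          gcongr
      _ = _ := by ring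
  have hen := global_energy hk hN hx0 hxN hlt hu hP hF hDG hbc
    (K := R * f2 * h ^ (k+3) * M) (by positivity) (by
      intro j hj s hs y hy
      have := hw2 j hj s hs 3 le_rfl y hy
      simpa using this) ht
  have hinit' : Real.sqrt (∑ j ∈ Finset.Icc 1 N, ∫ y in (x (j-1))..(x j),
        (errPoly k (x (j-1)) (x j) u0 (P j) (F j) (uh j) 0).eval y
          * (errPoly k (x (j-1)) (x j) u0 (P j) (F j) (uh j) 0).eval y)
      ≤ |C₀| * h ^ (k+3) * M := by
    simp only [errPoly_eval, ← sq]
    refine hinit.trans ?_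
    gcongr
    exact le_abs_self _
  set e := errPoly k (x (j-1)) (x j) u0 (P j) (F j) (uh j) t with he
  set Et := ∑ j ∈ Finset.Icc 1 N, ∫ y in (x (j-1))..(x j),
        (errPoly k (x (j-1)) (x j) u0 (P j) (F j) (uh j) t).eval y
          * (errPoly k (x (j-1)) (x j) u0 (P j) (F j) (uh j) t).eval y with hEt
  have ht0 : 0 ≤ t := ht.1
  have hEt1 : Real.sqrt Et ≤ A * (1 + t) * h ^ (k+3) * M := by
    refine (hen.trans (add_le_add_left hinit' _)).trans ?_
    have h1 : 0 ≤ |C₀| * t * (h ^ (k+3) * M) := by positivity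
    have h2 : 0 ≤ 3 * (R * f2) * (h ^ (k+3) * M) := by positivity
    rw [hA]
    nlinarith
  have hnn : ∀ j ∈ Finset.Icc 1 N, 0 ≤ ∫ y in (x (j-1))..(x j),
        (errPoly k (x (j-1)) (x j) u0 (P j) (F j) (uh j) t).eval y
          * (errPoly k (x (j-1)) (x j) u0 (P j) (F j) (uh j) t).eval y :=
    fun j hj => intervalIntegral.integral_nonneg (hlt j hj).le fun y _ => mul_self_nonneg _
  have hEt2 : Et ≤ (A * (1 + t) * h ^ (k+3) * M) ^ 2 := by
    have := (Real.sqrt_le_left (by positivity)).1 hEt1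
    exact this
  have hrI : r ∈ Set.Icc (x (j-1)) (x j) := Set.Ioo_subset_Icc_self hr
  have hba : 0 < x j - x (j-1) := by linarith [hlt j hj]
  have her : |e.eval r| ≤ 3 * R * c * A * ((1 + t) * h ^ (k+2) * M) := by
    apply abs_le_of_sq_le_sq _ (by positivity)
    have h1 := inverse_ineq (hlt j hj) hB1 (fun m hm => hBall m hm _ _ (hlt j hj)) e
      (errPoly_natDegree t (hP j hj t) (hF j hj) (hDG.1 j hj t)) hrI
    have h2 : ∫ y in (x (j-1))..(x j), e.eval y * e.eval y ≤ Et :=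
      Finset.single_le_sum (f := fun j => ∫ y in (x (j-1))..(x j),
        (errPoly k (x (j-1)) (x j) u0 (P j) (F j) (uh j) t).eval y
          * (errPoly k (x (j-1)) (x j) u0 (P j) (F j) (uh j) t).eval y) hnn hj
    have h3 : R ^ 2 / (x j - x (j-1)) ≤ R ^ 2 * c / h := by
      rw [div_le_div_iff₀ hba hh0]
      have := hqu j hj
      nlinarith [sq_nonneg R]
    calc _ ≤ R ^ 2 * c / h * (A * (1 + t) * h ^ (k+3) * M) ^ 2 := by
          refine h1.trans ?_
          have := hnn j hj
          refine mul_le_mul h3 (h2.trans hEt2) this (by positivity)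
      _ = R ^ 2 * c * h * (A * ((1 + t) * h ^ (k+2) * M)) ^ 2 := by
          field_simp
          ring
      _ ≤ R ^ 2 * c * (9 * c) * (A * ((1 + t) * h ^ (k+2) * M)) ^ 2 := by
          gcongr
      _ = _ := by ring
  have hgr := gr_radau_pt (hlt j hj) (u := fun y => u0 (y - t)) (by
      have : ContDiff ℝ (k+2) u0 := hu.of_le (by exact_mod_cast (by omega : k + 2 ≤ k + 4))
      fun_prop) (hP j hj t) hB1
      (fun m hm => hBall m hm _ _ (hlt j hj)) (S := M) (by
        intro y hy
        rw [iteratedDeriv_comp_sub_const]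
        exact hcellM j hj t ht _ (by omega) y hy) hrI (by
        rw [← legendreCell_eq, ← legendreCell_eq]; exact hroot)
  have hgr2 : |u0 (r - t) - (P j t).eval r| ≤ (1 + St) * h ^ (k+2) * M := by
    refine hgr.trans ?_
    rw [mul_assoc, mul_comm M]
    gcongr
    exact hhj j hj
  have hw2t := hw2 j hj t ht 2 (by norm_num) r hrI
  have hw2t' : R * f2 * h ^ (k+3) * M ≤ 9 * c * R * f2 * (h ^ (k+2) * M) := by
    have : R * f2 * h ^ (k+3) * M = h * (R * f2 * (h ^ (k+2) * M)) := by ring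
    rw [this]
    calc _ ≤ 9 * c * (R * f2 * (h ^ (k+2) * M)) := by gcongr
      _ = _ := by ring
  have hdec : u0 (r - t) - (uh j t).eval r = (u0 (r - t) - (P j t).eval r)
      + (x j - x (j-1)) / 2 * Gfun k (x (j-1)) (x j) u0 1 t * (F j 1).eval r
      + ((x j - x (j-1)) / 2) ^ 2 * Gfun k (x (j-1)) (x j) u0 2 t * (F j 2).eval r
      - e.eval r := by
    simp [he, errPoly]
  set Z := h ^ (k+2) * M with hZ
  have hZ0 : 0 ≤ Z := by positivity
  have htri : |u0 (r - t) - (uh j t).eval r| ≤ (1 + St) * Z + R * f1 * Z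
      + 9 * c * R * f2 * Z + 3 * R * c * A * ((1 + t) * Z) := by
    rw [hdec]
    refine (abs_sub _ _).trans (add_le_add ((abs_add_le _ _).trans
      (add_le_add ((abs_add_le _ _).trans (add_le_add ?_ ?_)) (hw2t.trans hw2t'))) ?_)
    · rw [hZ, ← mul_assoc]; exact hgr2
    · rw [hZ, ← mul_assoc]; exact hw1
    · rw [hZ, ← mul_assoc (1 + t)]; exact her
  refine htri.trans ?_
  rw [mul_assoc _ (h ^ (k+2)), ← hZ]
  have h1 : 0 ≤ ((1 + St) + R * f1 + 9 * c * R * f2) * t * Z := by positivity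
  have h2 : 0 ≤ (1 + t) * Z := by positivity
  nlinarith
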